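/- arXiv:2501.04375 — 4 statements merged into one kernel-verified Lean document; each statement's English description precedes it below -/
import Mathlib

section
/- Let A ⊂ {1,2,3,…} be a set of positive natural density d(A) = lim_{n→∞} #(A ∩ [1,n])/n > 0, and let F_A(s) = −Σ_{j∈A} ln(1 − e^{sj}) for s < 0 be the fulcrum of the ordinary generating function P_A(z) = ∏_{j∈A} (1 − z^j)^{−1} of partitions with parts in A. Then for every integer m ≥ 0, F_A^{(m)}(−s) ~ d(A)·ζ(2)·Γ(m + 1)·s^{−(m+1)} as s ↓ 0, i.e. the ratio of the two sides tends to 1. -/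
open scoped BigOperators Topology
open Filter

namespace KhinchinPaper

/-- Sum of the power series with coefficients `a` at `t`. -/
noncomputable def fsum (a : ℕ → ℝ) (t : ℝ) : ℝ := ∑' n : ℕ, a n * t ^ n

/-- The class `𝒦`: non-constant power series with non-negative coefficients, `a 0 > 0`,
and radius of convergence `R > 0`. -/
structure IsK (a : ℕ → ℝ) (R : ℝ) : Prop where
  pos₀ : 0 < a 0
  nonneg : ∀ n, 0 ≤ a n
  nonconst : ∃ n, 0 < n ∧ 0 < a n
  Rpos : 0 < R
  conv : ∀ t : ℝ, 0 ≤ t → t < R → Summable fun n : ℕ => a n * t ^ n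
  radius : ∀ t : ℝ, R < t → ¬ Summable fun n : ℕ => a n * t ^ n

/-- Mean function `m_f(t) = t f'(t)/f(t)`. -/
noncomputable def mf (a : ℕ → ℝ) (t : ℝ) : ℝ :=
  (∑' n : ℕ, (n : ℝ) * a n * t ^ n) / fsum a t

/-- Variance function `σ_f²(t)`. -/
noncomputable def sigma2 (a : ℕ → ℝ) (t : ℝ) : ℝ :=
  (∑' n : ℕ, (n : ℝ) ^ 2 * a n * t ^ n) / fsum a t - (mf a t) ^ 2

noncomputable def sigma (a : ℕ → ℝ) (t : ℝ) : ℝ := Real.sqrt (sigma2 a t)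

/-- `k`-th moment of the normalized Khinchin family variable `X̆_t`. -/
noncomputable def normMoment (a : ℕ → ℝ) (t : ℝ) (k : ℕ) : ℝ :=
  ∑' n : ℕ, (a n * t ^ n / fsum a t) * (((n : ℝ) - mf a t) / sigma a t) ^ k

/-- `k`-th central moment of `X_t`. -/
noncomputable def centralMoment (a : ℕ → ℝ) (t : ℝ) (k : ℕ) : ℝ :=
  ∑' n : ℕ, (a n * t ^ n / fsum a t) * ((n : ℝ) - mf a t) ^ k

/-- Characteristic function `E(e^{iθ X̆_t})` of the normalized variable. -/
noncomputable def charfun (a : ℕ → ℝ) (t θ : ℝ) : ℂ :=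
  ∑' n : ℕ, ((a n * t ^ n / fsum a t : ℝ) : ℂ) *
    Complex.exp (Complex.I * (θ : ℂ) * ((((n : ℝ) - mf a t) / sigma a t : ℝ) : ℂ))

/-- `f` is Gaussian: `X̆_t → N(0,1)` in distribution as `t ↑ R`, expressed via
pointwise convergence of characteristic functions (Lévy's continuity theorem). -/
def IsGaussian (a : ℕ → ℝ) (R : ℝ) : Prop :=
  ∀ θ : ℝ, Tendsto (fun t => charfun a t θ) (𝓝[<] R)
    (𝓝 (Complex.exp (-(θ : ℂ) ^ 2 / 2)))

/-- Gaussian for entire `f` (radius `R = ∞`, so `t → +∞`). -/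
def IsGaussianEntire (a : ℕ → ℝ) : Prop :=
  ∀ θ : ℝ, Tendsto (fun t => charfun a t θ) atTop
    (𝓝 (Complex.exp (-(θ : ℂ) ^ 2 / 2)))

/-- The fulcrum `F(s) = log f(e^s)` restricted to the real axis. -/
noncomputable def fulcrum (a : ℕ → ℝ) (s : ℝ) : ℝ := Real.log (fsum a (Real.exp s))

/-- The quotient `F^{(j)}(s) / F''(s)^{j/2}`. -/
noncomputable def Fq (a : ℕ → ℝ) (j : ℕ) (s : ℝ) : ℝ :=
  iteratedDeriv j (fulcrum a) s / (iteratedDeriv 2 (fulcrum a) s) ^ ((j : ℝ) / 2)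

/-- Tuples `(m₂, …, m_n)` of non-negative integers with `2m₂ + ⋯ + n m_n = n`,
padded with `m₀ = m₁ = 0` and encoded as functions on `Fin (n+1)`. -/
def tuples (n : ℕ) : Finset (Fin (n + 1) → ℕ) :=
  (Fintype.piFinset fun _ : Fin (n + 1) => Finset.range (n + 1)).filter
    fun m => m 0 = 0 ∧ m 1 = 0 ∧ ∑ j : Fin (n + 1), (j : ℕ) * m j = n

/-- Integer moments of a standard normal random variable `Z`. -/
noncomputable def gaussMoment (k : ℕ) : ℝ :=
  if Even k then (Nat.factorial k : ℝ) / ((Nat.factorial (k / 2) : ℝ) * 2 ^ (k / 2)) else 0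

/-- The complex power series sum. -/
noncomputable def fsumC (a : ℕ → ℝ) (z : ℂ) : ℂ := ∑' n : ℕ, (a n : ℂ) * z ^ n

/-- The complex fulcrum `F(z) = log f(e^z)`. -/
noncomputable def fulcrumC (a : ℕ → ℝ) (z : ℂ) : ℂ := Complex.log (fsumC a (Complex.exp z))

end KhinchinPaper

namespace KhinchinPaper

section

open MeasureTheory

theorem integrableOn_pow_mul_exp_neg (n : ℕ) :
    IntegrableOn (fun y : ℝ => y ^ n * Real.exp (-y)) (Set.Ioi 0) := by
  refine (Real.GammaIntegral_convergent (s := n + 1) (by positivity)).congr_fun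
    (fun y _ => ?_) measurableSet_Ioi
  simp [mul_comm]

theorem integral_pow_mul_exp_neg (n : ℕ) :
    ∫ y in Set.Ioi (0 : ℝ), y ^ n * Real.exp (-y) = n.factorial := by
  rw [← Real.Gamma_nat_eq_factorial, Real.Gamma_eq_integral (by positivity)]
  refine setIntegral_congr_fun measurableSet_Ioi fun y _ => ?_
  simp [mul_comm]

/-- The summatory function of `c`, evaluated at a real argument. -/
noncomputable def summatory (c : ℕ → ℝ) (t : ℝ) : ℝ := ∑ k ∈ Finset.Icc 0 ⌊t⌋₊, c k

/-- The negative of the derivative of `y ^ m * exp (-y)`. -/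
noncomputable def abelKernel (m : ℕ) (y : ℝ) : ℝ := (y ^ m - m * y ^ (m - 1)) * Real.exp (-y)

theorem abelKernel_mul_self (m : ℕ) (y : ℝ) :
    abelKernel m y * y = y ^ (m + 1) * Real.exp (-y) - m * (y ^ m * Real.exp (-y)) := by
  rcases m with _ | m
  · simp [abelKernel]; ring
  · simp [abelKernel]; ring

theorem integrableOn_abelKernel_mul_self (m : ℕ) :
    IntegrableOn (fun y : ℝ => abelKernel m y * y) (Set.Ioi 0) := by
  simp_rw [abelKernel_mul_self]
  exact (integrableOn_pow_mul_exp_neg _).sub ((integrableOn_pow_mul_exp_neg _).const_mul _)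

theorem integral_abelKernel_mul_self (m : ℕ) :
    ∫ y in Set.Ioi (0 : ℝ), abelKernel m y * y = m.factorial := by
  simp_rw [abelKernel_mul_self]
  rw [integral_sub (integrableOn_pow_mul_exp_neg _)
    ((integrableOn_pow_mul_exp_neg _).const_mul _), integral_const_mul,
    integral_pow_mul_exp_neg, integral_pow_mul_exp_neg, Nat.factorial_succ]
  push_cast
  ring

theorem hasDerivAt_pow_mul_exp (m : ℕ) (x t : ℝ) :
    HasDerivAt (fun t : ℝ => t ^ m * Real.exp (-(x * t)))
      ((m * t ^ (m - 1) - x * t ^ m) * Real.exp (-(x * t))) t := by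
  have h := (hasDerivAt_pow m t).mul ((hasDerivAt_id t).const_mul x).neg.exp
  convert! h using 1
  simp
  ring

theorem summatory_nonneg {c : ℕ → ℝ} (hc : ∀ n, 0 ≤ c n) (t : ℝ) : 0 ≤ summatory c t :=
  Finset.sum_nonneg fun _ _ => hc _

theorem summatory_le {c : ℕ → ℝ} (hc0 : c 0 = 0) (hc1 : ∀ n, c n ≤ 1) {t : ℝ} (ht : 0 ≤ t) :
    summatory c t ≤ t := by
  refine le_trans ?_ (Nat.floor_le ht)
  rw [summatory, ← Nat.range_succ_eq_Icc_zero, Finset.sum_range_succ', hc0, add_zero]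
  simpa using Finset.sum_le_card_nsmul (Finset.range ⌊t⌋₊) (fun k => c (k + 1)) 1 fun k _ => hc1 _

theorem summable_pow_mul_exp (m : ℕ) {x : ℝ} (hx : 0 < x) :
    Summable fun j : ℕ => (j : ℝ) ^ m * Real.exp (-(x * j)) := by
  simpa [neg_mul] using Real.summable_pow_mul_exp_neg_nat_mul m hx

theorem summable_mul_pow_mul_exp {c : ℕ → ℝ} (hc : ∀ n, 0 ≤ c n) (hc1 : ∀ n, c n ≤ 1) (m : ℕ)
    {x : ℝ} (hx : 0 < x) :
    Summable fun j : ℕ => (j : ℝ) ^ m * Real.exp (-(x * j)) * c j :=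
  (summable_pow_mul_exp m hx).of_nonneg_of_le
    (fun j => mul_nonneg (by positivity) (hc j))
    fun j => mul_le_of_le_one_right (by positivity) (hc1 j)

theorem abelKernel_mul_left (m : ℕ) (x t : ℝ) :
    x * abelKernel m (x * t) =
      -(x ^ m * ((m * t ^ (m - 1) - x * t ^ m) * Real.exp (-(x * t)))) := by
  rcases m with _ | m
  · simp [abelKernel]
  · simp [abelKernel]; ring

theorem norm_summatory_scaled_le {c : ℕ → ℝ} (hc0 : c 0 = 0) (hc : ∀ n, 0 ≤ c n)
    (hc1 : ∀ n, c n ≤ 1) (m : ℕ) {x y : ℝ} (hx : 0 < x) (hy : 0 < y) :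
    ‖abelKernel m y * (x * summatory c (y / x))‖ ≤ ‖abelKernel m y * y‖ := by
  rw [norm_mul, norm_mul (abelKernel m y) y]
  refine mul_le_mul_of_nonneg_left ?_ (norm_nonneg (abelKernel m y))
  rw [Real.norm_of_nonneg (mul_nonneg hx.le (summatory_nonneg hc _)), Real.norm_of_nonneg hy.le]
  calc x * summatory c (y / x) ≤ x * (y / x) := by
        gcongr; exact summatory_le hc0 hc1 (by positivity)
    _ = y := by field_simp

theorem tsum_eq_integral_abelKernel {c : ℕ → ℝ} (hc0 : c 0 = 0) (hc : ∀ n, 0 ≤ c n)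
    (hc1 : ∀ n, c n ≤ 1) (m : ℕ) {x : ℝ} (hx : 0 < x) :
    x ^ (m + 1) * ∑' j : ℕ, (j : ℝ) ^ m * Real.exp (-(x * j)) * c j =
      ∫ y in Set.Ioi (0 : ℝ), abelKernel m y * (x * summatory c (y / x)) := by
  have hderiv : deriv (fun t : ℝ => t ^ m * Real.exp (-(x * t))) =
      fun t => (m * t ^ (m - 1) - x * t ^ m) * Real.exp (-(x * t)) :=
    funext fun t => (hasDerivAt_pow_mul_exp m x t).deriv
  have hscale : ∀ t : ℝ, deriv (fun t : ℝ => t ^ m * Real.exp (-(x * t))) t =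
      -(x / x ^ m * abelKernel m (x * t)) := fun t => by
    have := abelKernel_mul_left m x t
    rw [hderiv]
    field_simp
    linear_combination this
  have hsum : Tendsto
      (fun n : ℕ => ∑ k ∈ Finset.Icc 0 n, (k : ℝ) ^ m * Real.exp (-(x * k)) * c k) atTop
      (𝓝 (0 - ∫ t in Set.Ioi (0 : ℝ),
        deriv (fun t : ℝ => t ^ m * Real.exp (-(x * t))) t *
          ∑ k ∈ Finset.Icc 0 ⌊t⌋₊, c k)) := by
    refine tendsto_sum_mul_atTop_nhds_one_sub_integral c
      (fun t _ => (hasDerivAt_pow_mul_exp m x t).differentiableAt) ?_ ?_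
      (g := fun t => abelKernel m (x * t) * (x * t)) ?_ ?_
    · rw [hderiv]
      exact Continuous.locallyIntegrable (by fun_prop) |>.locallyIntegrableOn _
    · have h0 := (summable_pow_mul_exp (m + 1) hx).tendsto_atTop_zero
      refine squeeze_zero (fun n => mul_nonneg (by positivity) (Finset.sum_nonneg fun _ _ => hc _))
        (fun n => ?_) h0
      have := summatory_le hc0 hc1 (Nat.cast_nonneg (α := ℝ) n)
      rw [summatory, Nat.floor_natCast] at this
      calc _ ≤ (n : ℝ) ^ m * Real.exp (-(x * n)) * n := by gcongr
        _ = _ := by ring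
    · refine Asymptotics.IsBigO.of_bound ‖(x ^ m)⁻¹‖ ?_
      filter_upwards [eventually_gt_atTop 0] with t ht
      have h := norm_summatory_scaled_le hc0 hc hc1 m hx (mul_pos hx ht)
      rw [mul_div_cancel_left₀ _ hx.ne'] at h
      rw [hscale]
      calc _ = ‖(x ^ m)⁻¹‖ * ‖abelKernel m (x * t) * (x * summatory c t)‖ := by
            rw [← norm_mul, ← norm_neg, summatory]
            congr 1
            field_simp
        _ ≤ _ := by gcongr
    · refine ⟨Set.Ioi 0, Ioi_mem_atTop 0, ?_⟩
      rw [integrableOn_Ioi_comp_mul_left_iff (fun y => abelKernel m y * y) 0 hx, mul_zero]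
      exact integrableOn_abelKernel_mul_self m
  have htsum : ∑' j : ℕ, (j : ℝ) ^ m * Real.exp (-(x * j)) * c j =
      0 - ∫ t in Set.Ioi (0 : ℝ), deriv (fun t : ℝ => t ^ m * Real.exp (-(x * t))) t *
          ∑ k ∈ Finset.Icc 0 ⌊t⌋₊, c k := by
    refine tendsto_nhds_unique ?_ hsum
    have := (summable_mul_pow_mul_exp hc hc1 m hx).hasSum.tendsto_sum_nat.comp
      (tendsto_add_atTop_nat 1)
    simpa [Function.comp_def, Nat.range_succ_eq_Icc_zero] using this
  have hsubst := integral_comp_mul_left_Ioi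
    (fun y => abelKernel m y * (x * summatory c (y / x))) 0 hx
  rw [mul_zero, smul_eq_mul, eq_inv_mul_iff_mul_eq₀ hx.ne', ← integral_const_mul] at hsubst
  rw [htsum, ← hsubst, zero_sub, ← integral_neg, ← integral_const_mul]
  refine integral_congr_ae (.of_forall fun t => ?_)
  simp only [hscale, mul_div_cancel_left₀ _ hx.ne', summatory]
  field_simp
  ring

theorem abs_pow_mul_tsum_le {c : ℕ → ℝ} (hc0 : c 0 = 0) (hc : ∀ n, 0 ≤ c n)
    (hc1 : ∀ n, c n ≤ 1) (m : ℕ) {x : ℝ} (hx : 0 < x) :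
    ‖x ^ (m + 1) * ∑' j : ℕ, (j : ℝ) ^ m * Real.exp (-(x * j)) * c j‖ ≤
      ∫ y in Set.Ioi (0 : ℝ), ‖abelKernel m y * y‖ := by
  rw [tsum_eq_integral_abelKernel hc0 hc hc1 m hx]
  refine norm_integral_le_of_norm_le (integrableOn_abelKernel_mul_self m).norm ?_
  filter_upwards [ae_restrict_mem measurableSet_Ioi] with y hy
  exact norm_summatory_scaled_le hc0 hc hc1 m hx hy

theorem measurable_summatory (c : ℕ → ℝ) : Measurable (summatory c) :=
  (measurable_from_top (f := fun n : ℕ => ∑ k ∈ Finset.Icc 0 n, c k)).comp Nat.measurable_floor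

theorem tendsto_summatory_div {c : ℕ → ℝ} {d : ℝ}
    (hd : Tendsto (fun n : ℕ => (∑ k ∈ Finset.Icc 0 n, c k) / n) atTop (𝓝 d)) :
    Tendsto (fun t : ℝ => summatory c t / t) atTop (𝓝 d) := by
  have h1 := hd.comp (tendsto_nat_floor_atTop (α := ℝ))
  have h2 := tendsto_nat_floor_mul_div_atTop (R := ℝ) zero_le_one
  have h3 := h1.mul h2
  rw [mul_one] at h3
  refine h3.congr' ?_
  filter_upwards [eventually_ge_atTop 1] with t ht
  have : (⌊t⌋₊ : ℝ) ≠ 0 := by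
    exact_mod_cast (Nat.floor_pos.mpr ht).ne'
  simp only [Function.comp_apply, one_mul, summatory]
  field_simp

/-- An Abelian theorem: if `c` has mean value `d`, then `∑ j ^ m * exp (-x j) * c j` is
asymptotic to `d * m! / x ^ (m + 1)` as `x ↓ 0`. -/
theorem tendsto_pow_mul_tsum {c : ℕ → ℝ} (hc0 : c 0 = 0) (hc : ∀ n, 0 ≤ c n)
    (hc1 : ∀ n, c n ≤ 1) {d : ℝ}
    (hd : Tendsto (fun n : ℕ => (∑ k ∈ Finset.Icc 0 n, c k) / n) atTop (𝓝 d)) (m : ℕ) :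
    Tendsto (fun x : ℝ => x ^ (m + 1) * ∑' j : ℕ, (j : ℝ) ^ m * Real.exp (-(x * j)) * c j)
      (𝓝[>] 0) (𝓝 (d * m.factorial)) := by
  have hlim : d * (m.factorial : ℝ) = ∫ y in Set.Ioi (0 : ℝ), abelKernel m y * y * d := by
    rw [integral_mul_const, integral_abelKernel_mul_self, mul_comm]
  rw [hlim]
  refine (tendsto_integral_filter_of_dominated_convergence
    (F := fun x y => abelKernel m y * (x * summatory c (y / x)))
    (fun y => ‖abelKernel m y * y‖) ?_ ?_ (integrableOn_abelKernel_mul_self m).norm ?_).congr' ?_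
  · refine .of_forall fun x => Measurable.aestronglyMeasurable ?_
    have := measurable_summatory c
    unfold abelKernel
    fun_prop
  · filter_upwards [self_mem_nhdsWithin] with x hx
    filter_upwards [ae_restrict_mem measurableSet_Ioi] with y hy
    exact norm_summatory_scaled_le hc0 hc hc1 m hx hy
  · filter_upwards [ae_restrict_mem measurableSet_Ioi] with y (hy : 0 < y)
    have hdiv : Tendsto (fun x : ℝ => y / x) (𝓝[>] 0) atTop := by
      simpa [div_eq_mul_inv] using tendsto_inv_nhdsGT_zero.const_mul_atTop hy
    refine (((tendsto_summatory_div hd).comp hdiv).const_mul (abelKernel m y * y)).congr' ?_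
    filter_upwards [self_mem_nhdsWithin] with x (hx : 0 < x)
    simp only [Function.comp_apply]
    field_simp
  · filter_upwards [self_mem_nhdsWithin] with x hx
    exact (tsum_eq_integral_abelKernel hc0 hc hc1 m hx).symm

/-- The `m`-th derivative in `u` of the `(j, k)` term `c j * exp (u j (k + 1)) / (k + 1)` of the
expansion of `-∑ c j * log (1 - exp (u j))`. -/
noncomputable def logTerm (c : ℕ → ℝ) (m : ℕ) (u : ℝ) (p : ℕ × ℕ) : ℝ :=
  c p.1 * ((p.1 * (p.2 + 1) : ℝ) ^ m / (p.2 + 1) * Real.exp (u * (p.1 * (p.2 + 1))))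

theorem hasDerivAt_logTerm (c : ℕ → ℝ) (m : ℕ) (p : ℕ × ℕ) (u : ℝ) :
    HasDerivAt (fun u => logTerm c m u p) (logTerm c (m + 1) u p) u := by
  have h := (((hasDerivAt_id u).mul_const (p.1 * (p.2 + 1) : ℝ)).exp.const_mul
    ((p.1 * (p.2 + 1) : ℝ) ^ m / (p.2 + 1))).const_mul (c p.1)
  convert! h using 1
  simp only [logTerm, id]
  ring

theorem norm_logTerm_le {c : ℕ → ℝ} (hc0 : c 0 = 0) (hc : ∀ n, 0 ≤ c n) (hc1 : ∀ n, c n ≤ 1)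
    (m : ℕ) {r u : ℝ} (hr : 0 < r) (hu : u ≤ -r) (p : ℕ × ℕ) :
    ‖logTerm c m u p‖ ≤ ((p.1 : ℝ) ^ m * Real.exp (-(r * p.1))) *
      (((p.2 : ℝ) + 1) ^ m * Real.exp (-(r * p.2))) := by
  obtain ⟨j, k⟩ := p
  rcases Nat.eq_zero_or_pos j with rfl | hj
  · simp only [logTerm, hc0, zero_mul, norm_zero]
    positivity
  have hj' : (1 : ℝ) ≤ j := by exact_mod_cast hj
  have hk : (0 : ℝ) ≤ k := k.cast_nonneg
  have hexp : u * (j * (k + 1)) ≤ -(r * j) + -(r * k) := by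
    have h1 : u * (j * (k + 1)) ≤ -r * (j * (k + 1)) := by gcongr
    nlinarith [mul_nonneg hr.le (mul_nonneg (sub_nonneg.mpr hj') hk)]
  have hnn : 0 ≤ logTerm c m u (j, k) := mul_nonneg (hc _) (by positivity)
  rw [Real.norm_of_nonneg hnn]
  calc logTerm c m u (j, k)
      ≤ 1 * ((j * (k + 1) : ℝ) ^ m / 1 * Real.exp (-(r * j) + -(r * k))) := by
        simp only [logTerm]
        gcongr
        · exact hc1 j
        · linarith
    _ = _ := by rw [Real.exp_add, mul_pow]; ring

theorem summable_logTerm_bound (m : ℕ) {r : ℝ} (hr : 0 < r) :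
    Summable fun p : ℕ × ℕ => ((p.1 : ℝ) ^ m * Real.exp (-(r * p.1))) *
      (((p.2 : ℝ) + 1) ^ m * Real.exp (-(r * p.2))) := by
  refine (summable_pow_mul_exp m hr).mul_of_nonneg (g := fun k : ℕ =>
    ((k : ℝ) + 1) ^ m * Real.exp (-(r * k))) ?_ (fun _ => by positivity) fun _ => by positivity
  refine (((summable_nat_add_iff 1).mpr (summable_pow_mul_exp m hr)).mul_left
    (Real.exp r)).congr fun k => ?_
  rw [mul_left_comm, ← Real.exp_add]
  push_cast
  ring_nf

theorem summable_logTerm {c : ℕ → ℝ} (hc0 : c 0 = 0) (hc : ∀ n, 0 ≤ c n) (hc1 : ∀ n, c n ≤ 1)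
    (m : ℕ) {u : ℝ} (hu : u < 0) : Summable (logTerm c m u) :=
  (summable_logTerm_bound m (neg_pos.mpr hu)).of_norm_bounded
    (norm_logTerm_le hc0 hc hc1 m (neg_pos.mpr hu) (neg_neg u).ge)

theorem hasDerivAt_tsum_logTerm {c : ℕ → ℝ} (hc0 : c 0 = 0) (hc : ∀ n, 0 ≤ c n)
    (hc1 : ∀ n, c n ≤ 1) (m : ℕ) {u : ℝ} (hu : u < 0) :
    HasDerivAt (fun u => ∑' p, logTerm c m u p) (∑' p, logTerm c (m + 1) u p) u := by
  have hr : 0 < -u / 2 := by linarith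
  have hmem : u ∈ Set.Iio (-(-u / 2)) := by
    rw [Set.mem_Iio]
    linarith
  exact hasDerivAt_tsum_of_isPreconnected (summable_logTerm_bound (m + 1) hr) isOpen_Iio
    isPreconnected_Iio (fun p y _ => hasDerivAt_logTerm c m p y)
    (fun p y hy => norm_logTerm_le hc0 hc hc1 (m + 1) hr (le_of_lt hy) p) hmem
    (summable_logTerm hc0 hc hc1 m hu) hmem

theorem iteratedDeriv_eq_tsum_logTerm {c : ℕ → ℝ} (hc0 : c 0 = 0) (hc : ∀ n, 0 ≤ c n)
    (hc1 : ∀ n, c n ≤ 1) {F : ℝ → ℝ} (hF : ∀ u < 0, F u = ∑' p, logTerm c 0 u p) (m : ℕ) :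
    ∀ u < 0, iteratedDeriv m F u = ∑' p, logTerm c m u p := by
  induction m with
  | zero => simpa using hF
  | succ m ih =>
    intro u hu
    rw [iteratedDeriv_succ]
    have heq : iteratedDeriv m F =ᶠ[𝓝 u] fun u => ∑' p, logTerm c m u p := by
      filter_upwards [Iio_mem_nhds hu] with v hv using ih v hv
    rw [heq.deriv_eq]
    exact (hasDerivAt_tsum_logTerm hc0 hc hc1 m hu).deriv

theorem tsum_logTerm_zero {c : ℕ → ℝ} (hc0 : c 0 = 0) (hc : ∀ n, 0 ≤ c n) (hc1 : ∀ n, c n ≤ 1)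
    {u : ℝ} (hu : u < 0) :
    ∑' p, logTerm c 0 u p = -∑' j : ℕ, c j * Real.log (1 - Real.exp (u * j)) := by
  rw [(summable_logTerm hc0 hc hc1 0 hu).tsum_prod, ← tsum_neg]
  refine tsum_congr fun j => ?_
  rcases Nat.eq_zero_or_pos j with rfl | hj
  · simp [logTerm, hc0]
  have hlt : |Real.exp (u * j)| < 1 := by
    rw [abs_of_pos (Real.exp_pos _), Real.exp_lt_one_iff]
    exact mul_neg_of_neg_of_pos hu (by exact_mod_cast hj)
  rw [← mul_neg, ← (Real.hasSum_pow_div_log_of_abs_lt_one hlt).tsum_eq, ← tsum_mul_left]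
  refine tsum_congr fun k => ?_
  rw [← Real.exp_nat_mul]
  simp only [logTerm]
  push_cast
  ring_nf

theorem pow_mul_tsum_logTerm {c : ℕ → ℝ} (hc0 : c 0 = 0) (hc : ∀ n, 0 ≤ c n)
    (hc1 : ∀ n, c n ≤ 1) (m : ℕ) {s : ℝ} (hs : 0 < s) :
    s ^ (m + 1) * ∑' p, logTerm c m (-s) p = ∑' k : ℕ, 1 / ((k : ℝ) + 1) ^ 2 *
      ((s * (k + 1)) ^ (m + 1) *
        ∑' j : ℕ, (j : ℝ) ^ m * Real.exp (-(s * (k + 1) * j)) * c j) := by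
  have hsum := summable_logTerm hc0 hc hc1 m (neg_neg_of_pos hs)
  rw [← (Equiv.prodComm ℕ ℕ).tsum_eq,
    Summable.tsum_prod (f := fun p => logTerm c m (-s) (Equiv.prodComm ℕ ℕ p))
      ((Equiv.prodComm ℕ ℕ).summable_iff.mpr hsum),
    ← tsum_mul_left]
  refine tsum_congr fun k => ?_
  simp only [← tsum_mul_left]
  refine tsum_congr fun j => ?_
  have hexp : -s * (j * ((k : ℝ) + 1)) = -(s * (k + 1) * j) := by ring
  simp only [logTerm, Equiv.prodComm_apply, Prod.swap_prod_mk, hexp, mul_pow, pow_succ]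
  field_simp

theorem hasSum_one_div_succ_sq :
    HasSum (fun k : ℕ => 1 / ((k : ℝ) + 1) ^ 2) (Real.pi ^ 2 / 6) := by
  simpa using (hasSum_nat_add_iff' 1).mpr hasSum_zeta_two

theorem tendsto_pow_mul_tsum_logTerm {c : ℕ → ℝ} (hc0 : c 0 = 0) (hc : ∀ n, 0 ≤ c n)
    (hc1 : ∀ n, c n ≤ 1) {d : ℝ}
    (hd : Tendsto (fun n : ℕ => (∑ k ∈ Finset.Icc 0 n, c k) / n) atTop (𝓝 d)) (m : ℕ) :
    Tendsto (fun s : ℝ => s ^ (m + 1) * ∑' p, logTerm c m (-s) p) (𝓝[>] 0)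
      (𝓝 (Real.pi ^ 2 / 6 * (d * m.factorial))) := by
  rw [← (hasSum_one_div_succ_sq.mul_right (d * (m.factorial : ℝ))).tsum_eq]
  refine (tendsto_tsum_of_dominated_convergence
    (f := fun s (k : ℕ) => 1 / ((k : ℝ) + 1) ^ 2 * ((s * (k + 1)) ^ (m + 1) *
        ∑' j : ℕ, (j : ℝ) ^ m * Real.exp (-(s * (k + 1) * j)) * c j))
    (hasSum_one_div_succ_sq.summable.mul_right
      (∫ y in Set.Ioi (0 : ℝ), ‖abelKernel m y * y‖)) (fun k => ?_) ?_).congr' ?_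
  · have hscale : Tendsto (fun s : ℝ => s * ((k : ℝ) + 1)) (𝓝[>] 0) (𝓝[>] 0) := by
      refine tendsto_nhdsWithin_iff.mpr ⟨?_, ?_⟩
      · exact tendsto_nhdsWithin_of_tendsto_nhds (Continuous.tendsto' (by fun_prop) _ _ (by simp))
      · filter_upwards [self_mem_nhdsWithin] with s (hs : 0 < s)
        exact mul_pos hs (by positivity)
    exact ((tendsto_pow_mul_tsum hc0 hc hc1 hd m).comp hscale).const_mul _
  · filter_upwards [self_mem_nhdsWithin] with s (hs : 0 < s) k
    rw [norm_mul, Real.norm_of_nonneg (by positivity : (0 : ℝ) ≤ 1 / ((k : ℝ) + 1) ^ 2)]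
    gcongr
    exact abs_pow_mul_tsum_le hc0 hc hc1 m (mul_pos hs (by positivity))
  · filter_upwards [self_mem_nhdsWithin] with s hs
    exact (pow_mul_tsum_logTerm hc0 hc hc1 m hs).symm

end

/-- for a set `A` of positive natural density `d(A)`, the fulcrum
`F_A(s) = -∑_{j∈A} ln(1 - e^{sj})` satisfies
`F_A^{(m)}(-s) ~ d(A) ζ(2) Γ(m+1) / s^{m+1}` as `s ↓ 0`. -/
theorem statement15 (A : Set ℕ) [DecidablePred (· ∈ A)] (hA : ∀ n ∈ A, 1 ≤ n)
    (d : ℝ) (hd : 0 < d)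
    (hdens : Tendsto
      (fun n : ℕ => (((Finset.Icc 1 n).filter (· ∈ A)).card : ℝ) / n) atTop (𝓝 d))
    (m : ℕ) :
    Tendsto (fun s : ℝ =>
        iteratedDeriv m
            (fun u : ℝ => -∑' j : A, Real.log (1 - Real.exp (u * ((j : ℕ) : ℝ)))) (-s) /
          (d * (Real.pi ^ 2 / 6) * Real.Gamma ((m : ℝ) + 1) / s ^ (m + 1)))
      (𝓝[>] (0 : ℝ)) (𝓝 1) := by
  set c : ℕ → ℝ := A.indicator 1 with hc_def
  have hc0 : c 0 = 0 := Set.indicator_of_notMem (fun h => absurd (hA 0 h) (by simp)) _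
  have hc : ∀ n, 0 ≤ c n := fun n => Set.indicator_nonneg (fun _ _ => zero_le_one) n
  have hc1 : ∀ n, c n ≤ 1 := fun n => Set.indicator_le_self' (fun _ _ => zero_le_one) n
  have hmean : Tendsto (fun n : ℕ => (∑ k ∈ Finset.Icc 0 n, c k) / n) atTop (𝓝 d) := by
    refine hdens.congr fun n => ?_
    rw [← Finset.add_sum_Ioc_eq_sum_Icc n.zero_le, hc0, zero_add, Finset.card_filter]
    push_cast
    congr 1
    refine Finset.sum_congr rfl fun k _ => ?_
    simp [hc_def, Set.indicator_apply]
  have hF : ∀ u < 0, -∑' j : A, Real.log (1 - Real.exp (u * ((j : ℕ) : ℝ))) =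
      ∑' p, logTerm c 0 u p := fun u hu => by
    rw [tsum_logTerm_zero hc0 hc hc1 hu,
      tsum_subtype A fun j : ℕ => Real.log (1 - Real.exp (u * (j : ℝ)))]
    congr 1
    refine tsum_congr fun j => ?_
    simp [hc_def, Set.indicator_apply]
  have hne : d * (Real.pi ^ 2 / 6) * Real.Gamma ((m : ℝ) + 1) ≠ 0 :=
    (mul_pos (by positivity) (Real.Gamma_pos_of_pos (by positivity))).ne'
  have hlim := (tendsto_pow_mul_tsum_logTerm hc0 hc hc1 hmean m).div_const
    (d * (Real.pi ^ 2 / 6) * Real.Gamma ((m : ℝ) + 1))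
  rw [show Real.pi ^ 2 / 6 * (d * (m.factorial : ℝ)) =
      d * (Real.pi ^ 2 / 6) * Real.Gamma ((m : ℝ) + 1) by
    rw [Real.Gamma_nat_eq_factorial]; ring, div_self hne] at hlim
  refine hlim.congr' ?_
  filter_upwards [self_mem_nhdsWithin] with s (hs : 0 < s)
  rw [iteratedDeriv_eq_tsum_logTerm hc0 hc hc1 hF m (-s) (neg_neg_of_pos hs), div_div_eq_mul_div,
    mul_comm]

end KhinchinPaper
end

section
/- Let A ⊂ {1,2,3,…} be a set of positive natural density d(A) = lim_{n→∞} #(A ∩ [1,n])/n > 0. Then the ordinary generating function P_A(z) = ∏_{j∈A} (1 − z^j)^{−1} of partitions of integers with parts in A (a power series in 𝒦 with radius of convergence 1) is Gaussian: its normalized Khinchin family X̆_t converges in distribution to the standard normal N(0,1) as t ↑ 1. -/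
open scoped BigOperators Topology
open Filter

namespace KhinchinPaper

/-- The sum `∑ b i * exp (n i * z)`. -/
noncomputable def expSum {ι : Type*} (n : ι → ℕ) (b : ι → ℝ) (z : ℂ) : ℂ :=
  ∑' i, (b i : ℂ) * Complex.exp (n i * z)

/-- Absolute convergence of `expSum n b` on the open left half-plane. -/
def ExpSummable {ι : Type*} (n : ι → ℕ) (b : ι → ℝ) : Prop :=
  ∀ s : ℝ, 0 < s → Summable fun i => |b i| * Real.exp (-(n i * s))

section ExpSum

variable {ι : Type*} {n : ι → ℕ} {b : ι → ℝ}

lemma norm_expSum_term (n : ι → ℕ) (b : ι → ℝ) (i : ι) (z : ℂ) :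
    ‖(b i : ℂ) * Complex.exp (n i * z)‖ = |b i| * Real.exp (n i * z.re) := by
  rw [norm_mul, Complex.norm_real, Complex.norm_exp, Real.norm_eq_abs]
  simp

lemma ExpSummable.summable (h : ExpSummable n b) {z : ℂ} (hz : z.re < 0) :
    Summable fun i => (b i : ℂ) * Complex.exp (n i * z) := by
  refine Summable.of_norm ((h (-z.re) (by linarith)).congr fun i => ?_)
  rw [norm_expSum_term]
  congr 2
  ring

lemma ExpSummable.natCast_mul (h : ExpSummable n b) :
    ExpSummable n fun i => n i * b i := by
  intro s hs
  refine Summable.of_nonneg_of_le (fun i => by positivity) (fun i => ?_)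
    ((h (s / 2) (by positivity)).mul_left (2 / s))
  have h1 : (n i : ℝ) * (s / 2) ≤ Real.exp (n i * (s / 2)) := by
    linarith [Real.add_one_le_exp ((n i : ℝ) * (s / 2))]
  have h2 : (n i : ℝ) ≤ 2 / s * Real.exp (n i * (s / 2)) := by
    have : (n i : ℝ) = 2 / s * (n i * (s / 2)) := by field_simp
    calc (n i : ℝ) = 2 / s * (n i * (s / 2)) := this
      _ ≤ _ := by gcongr
  have h3 : Real.exp (n i * (s / 2)) * Real.exp (-(n i * s)) = Real.exp (-(n i * (s / 2))) := by
    rw [← Real.exp_add]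
    congr 1
    ring
  rw [abs_mul, Nat.abs_cast]
  calc (n i : ℝ) * |b i| * Real.exp (-(n i * s))
      ≤ 2 / s * Real.exp (n i * (s / 2)) * |b i| * Real.exp (-(n i * s)) := by gcongr
    _ = 2 / s * (|b i| * (Real.exp (n i * (s / 2)) * Real.exp (-(n i * s)))) := by ring
    _ = _ := by rw [h3]

lemma ExpSummable.hasDerivAt (h : ExpSummable n b) {z : ℂ} (hz : z.re < 0) :
    HasDerivAt (expSum n b) (expSum n (fun i => n i * b i) z) z := by
  set U : Set ℂ := {w | w.re < z.re / 2} with hU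
  have hUo : IsOpen U := isOpen_lt Complex.continuous_re continuous_const
  have hzU : z ∈ U := by change z.re < z.re / 2; linarith
  have hs := h (-(z.re / 2)) (by linarith)
  have hF : ∀ i, DifferentiableOn ℂ (fun w => (b i : ℂ) * Complex.exp (n i * w)) U :=
    fun i => by fun_prop
  have hle : ∀ i, ∀ w ∈ U, ‖(b i : ℂ) * Complex.exp (n i * w)‖ ≤
      |b i| * Real.exp (-(n i * -(z.re / 2))) := by
    intro i w hw
    rw [norm_expSum_term]
    have : w.re ≤ z.re / 2 := le_of_lt hw
    gcongr
    nlinarith [(Nat.cast_nonneg (n i) : (0 : ℝ) ≤ n i)]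
  have hd := Complex.differentiableOn_tsum_of_summable_norm hs hF hUo hle
  have hda := (hd.differentiableAt (hUo.mem_nhds hzU)).hasDerivAt
  have hsum := (Complex.hasSum_deriv_of_summable_norm hs hF hUo hle hzU).tsum_eq
  rw [← hsum] at hda
  refine hda.congr_deriv (tsum_congr fun i => ?_)
  have : HasDerivAt (fun w => (b i : ℂ) * Complex.exp (n i * w))
      ((b i : ℂ) * (Complex.exp (n i * z) * (n i * 1))) z :=
    (((hasDerivAt_id z).const_mul (n i : ℂ)).cexp).const_mul (b i : ℂ)
  rw [this.deriv]
  push_cast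
  ring

lemma ExpSummable.analyticOnNhd (h : ExpSummable n b) :
    AnalyticOnNhd ℂ (expSum n b) {z | z.re < 0} :=
  DifferentiableOn.analyticOnNhd
    (fun _ hz => (h.hasDerivAt hz).differentiableAt.differentiableWithinAt)
    (isOpen_lt Complex.continuous_re continuous_const)

lemma expSum_ofReal (n : ι → ℕ) (b : ι → ℝ) (x : ℝ) :
    expSum n b x = ((∑' i, b i * Real.exp (n i * x) : ℝ) : ℂ) := by
  rw [Complex.ofReal_tsum]
  exact tsum_congr fun i => by push_cast; rfl

lemma norm_exp_mul_I_sub_taylor_le (u : ℝ) :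
    ‖Complex.exp (u * Complex.I) - 1 - u * Complex.I + (u : ℂ) ^ 2 / 2‖ ≤ 4 * |u| ^ 3 := by
  have hn : ‖(u : ℂ) * Complex.I‖ = |u| := by simp
  rcases le_total |u| 1 with h | h
  · have := Complex.exp_bound (x := u * Complex.I) (by rwa [hn]) (n := 3) (by norm_num)
    rw [hn] at this
    have he : Complex.exp (u * Complex.I) - ∑ m ∈ Finset.range 3,
        ((u : ℂ) * Complex.I) ^ m / (m.factorial : ℂ) =
        Complex.exp (u * Complex.I) - 1 - u * Complex.I + (u : ℂ) ^ 2 / 2 := by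
      simp only [Finset.sum_range_succ, Finset.sum_range_zero, mul_pow, Complex.I_sq]
      norm_num [Nat.factorial]
      ring
    rw [he] at this
    refine this.trans ?_
    have h3 : 0 ≤ |u| ^ 3 := by positivity
    norm_num [Nat.factorial]
    nlinarith
  · have h1 : ‖Complex.exp (u * Complex.I)‖ = 1 := Complex.norm_exp_ofReal_mul_I u
    have h2 : ‖(u : ℂ) ^ 2 / 2‖ = |u| ^ 2 / 2 := by simp
    have := norm_add_le (Complex.exp (u * Complex.I) - 1 - u * Complex.I) ((u : ℂ) ^ 2 / 2)
    have h4 := norm_sub_le (Complex.exp (u * Complex.I) - 1) (u * Complex.I)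
    have h5 := norm_sub_le (Complex.exp (u * Complex.I)) 1
    rw [norm_one] at h5
    have : |u| ≤ |u| ^ 2 := by nlinarith
    have : |u| ^ 2 ≤ |u| ^ 3 := by nlinarith [sq_nonneg |u|]
    linarith

lemma ExpSummable.norm_taylor_le (h : ExpSummable n b) {s : ℝ} (hs : 0 < s) (φ : ℝ) :
    ‖expSum n b ((-s : ℝ) + φ * Complex.I) - expSum n b (-s : ℝ) -
      φ * Complex.I * expSum n (fun i => n i * b i) (-s : ℝ) +
      (φ : ℂ) ^ 2 / 2 * expSum n (fun i => n i * (n i * b i)) (-s : ℝ)‖ ≤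
      192 * |φ| ^ 3 / s ^ 3 * ∑' i, |b i| * Real.exp (-(n i * (s / 2))) := by
  have hre : ((-s : ℝ) : ℂ).re < 0 := by simpa
  have hre' : (((-s : ℝ) : ℂ) + φ * Complex.I).re < 0 := by simpa
  have s1 := h.summable hre'
  have s2 := h.summable hre
  have s3 := (h.natCast_mul.summable hre).mul_left (φ * Complex.I)
  have s4 := (h.natCast_mul.natCast_mul.summable hre).mul_left ((φ : ℂ) ^ 2 / 2)
  unfold expSum
  rw [← tsum_mul_left, ← tsum_mul_left, ← s1.tsum_sub s2, ← (s1.sub s2).tsum_sub s3,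
    ← ((s1.sub s2).sub s3).tsum_add s4]
  refine tsum_of_norm_bounded ((h (s / 2) (by positivity)).hasSum.mul_left _) fun i => ?_
  have hfac : (b i : ℂ) * Complex.exp (n i * ((-s : ℝ) + φ * Complex.I)) -
      (b i : ℂ) * Complex.exp (n i * (-s : ℝ)) -
      φ * Complex.I * (((n i * b i : ℝ) : ℂ) * Complex.exp (n i * (-s : ℝ))) +
      (φ : ℂ) ^ 2 / 2 * (((n i * (n i * b i) : ℝ) : ℂ) * Complex.exp (n i * (-s : ℝ))) =
      (b i : ℂ) * Complex.exp (n i * (-s : ℝ)) *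
        (Complex.exp ((n i * φ : ℝ) * Complex.I) - 1 - (n i * φ : ℝ) * Complex.I +
          ((n i * φ : ℝ) : ℂ) ^ 2 / 2) := by
    have : Complex.exp (n i * ((-s : ℝ) + φ * Complex.I)) =
        Complex.exp (n i * (-s : ℝ)) * Complex.exp ((n i * φ : ℝ) * Complex.I) := by
      rw [← Complex.exp_add]
      congr 1
      push_cast
      ring
    rw [this]
    push_cast
    ring
  rw [hfac, norm_mul, norm_expSum_term, Complex.ofReal_re]
  have hcube : (n i : ℝ) ^ 3 * Real.exp (-(n i * s)) ≤
      48 / s ^ 3 * Real.exp (-(n i * (s / 2))) := by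
    have h1 := Real.pow_div_factorial_le_exp ((n i : ℝ) * (s / 2)) (by positivity) 3
    have h2 : (n i : ℝ) ^ 3 = 48 / s ^ 3 * (((n i : ℝ) * (s / 2)) ^ 3 / (3 : ℕ).factorial) := by
      norm_num [Nat.factorial]
      field_simp
      ring
    have h3 : Real.exp (n i * (s / 2)) * Real.exp (-(n i * s)) =
        Real.exp (-(n i * (s / 2))) := by
      rw [← Real.exp_add]
      congr 1
      ring
    rw [h2, ← h3, mul_assoc]
    gcongr
  have habs : |(n i : ℝ) * φ| ^ 3 = (n i : ℝ) ^ 3 * |φ| ^ 3 := by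
    rw [abs_mul, Nat.abs_cast, mul_pow]
  calc |b i| * Real.exp (n i * -s) * _
      ≤ |b i| * Real.exp (n i * -s) * (4 * |(n i : ℝ) * φ| ^ 3) := by
        gcongr
        exact norm_exp_mul_I_sub_taylor_le _
    _ = 4 * |b i| * |φ| ^ 3 * ((n i : ℝ) ^ 3 * Real.exp (-(n i * s))) := by
        rw [habs, mul_neg]
        ring
    _ ≤ 4 * |b i| * |φ| ^ 3 * (48 / s ^ 3 * Real.exp (-(n i * (s / 2)))) := by gcongr
    _ = _ := by ring

end ExpSum

section ExpOfExpSum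

variable {ι : Type*} {n : ι → ℕ} {b : ι → ℝ} {a : ℕ → ℝ}

lemma ExpSummable.eqOn_of_ofReal {κ : Type*} {m : κ → ℕ} {c : κ → ℝ}
    (hc : ExpSummable m c) (hb : ExpSummable n b)
    (h : ∀ s : ℝ, 0 < s → expSum m c (-s : ℝ) = Complex.exp (expSum n b (-s : ℝ))) :
    Set.EqOn (expSum m c) (fun z => Complex.exp (expSum n b z)) {z | z.re < 0} := by
  refine AnalyticOnNhd.eqOn_of_preconnected_of_frequently_eq (z₀ := ((-1 : ℝ) : ℂ))
    hc.analyticOnNhd (fun z hz => (hb.analyticOnNhd z hz).cexp)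
    (convex_halfSpace_re_lt 0).isPreconnected (by simp) ?_
  have hmap : Tendsto (fun s : ℝ => ((-s : ℝ) : ℂ)) (𝓝[≠] 1) (𝓝[≠] ((-1 : ℝ) : ℂ)) := by
    refine tendsto_nhdsWithin_iff.2 ⟨?_, ?_⟩
    · exact ((by fun_prop : Continuous fun s : ℝ => ((-s : ℝ) : ℂ)).tendsto 1).mono_left
        nhdsWithin_le_nhds
    · filter_upwards [self_mem_nhdsWithin] with s hs
      simpa using hs
  refine hmap.frequently (Eventually.frequently ?_)
  filter_upwards [nhdsWithin_le_nhds (lt_mem_nhds (zero_lt_one' ℝ))] with s hs using h s hs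

lemma ExpSummable.natCast_mul_eq_of_eqOn_exp {κ : Type*} {m : κ → ℕ} {c : κ → ℝ}
    (hc : ExpSummable m c) (hb : ExpSummable n b)
    (h : Set.EqOn (expSum m c) (fun z => Complex.exp (expSum n b z)) {z | z.re < 0})
    {z : ℂ} (hz : z.re < 0) :
    expSum m (fun k => m k * c k) z =
        expSum n (fun i => n i * b i) z * Complex.exp (expSum n b z) ∧
      expSum m (fun k => m k * (m k * c k)) z =
        (expSum n (fun i => n i * (n i * b i)) z + expSum n (fun i => n i * b i) z ^ 2) *
          Complex.exp (expSum n b z) := by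
  have hopen : IsOpen {z : ℂ | z.re < 0} := isOpen_lt Complex.continuous_re continuous_const
  have h1 : Set.EqOn (expSum m (fun k => m k * c k))
      (fun z => expSum n (fun i => n i * b i) z * Complex.exp (expSum n b z))
      {z | z.re < 0} := by
    intro w hw
    have hd := (hb.hasDerivAt hw).cexp
    rw [mul_comm] at hd
    exact (hc.hasDerivAt hw).unique
      (hd.congr_of_eventuallyEq (h.eventuallyEq_of_mem (hopen.mem_nhds hw)))
  refine ⟨h1 hz, ?_⟩
  have hd := (hb.natCast_mul.hasDerivAt hz).mul (hb.hasDerivAt hz).cexp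
  rw [(hc.natCast_mul.hasDerivAt hz).unique
    (hd.congr_of_eventuallyEq (h1.eventuallyEq_of_mem (hopen.mem_nhds hz)))]
  ring

lemma exp_neg_pow_eq (s : ℝ) (k : ℕ) : Real.exp (-s) ^ k = Real.exp (k * -s) := by
  rw [← Real.exp_nat_mul]

lemma fsum_exp_neg (a : ℕ → ℝ) (s : ℝ) :
    (fsum a (Real.exp (-s)) : ℂ) = expSum (fun k => k) a (-s : ℝ) := by
  rw [expSum_ofReal]
  simp only [fsum, exp_neg_pow_eq]

/-- If `f(e^z) = exp (∑ b i * exp (n i * z))`, the mean function of `f` is the first derivative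
of the exponent. -/
lemma mf_eq_of_eqOn_exp (ha : ExpSummable (fun k => k) a) (hb : ExpSummable n b)
    (h : Set.EqOn (expSum (fun k => k) a) (fun z => Complex.exp (expSum n b z)) {z | z.re < 0})
    {s : ℝ} (hs : 0 < s) :
    (mf a (Real.exp (-s)) : ℂ) = expSum n (fun i => n i * b i) (-s : ℝ) := by
  have hre : ((-s : ℝ) : ℂ).re < 0 := by simpa
  have h1 := (ha.natCast_mul_eq_of_eqOn_exp hb h hre).1
  rw [mf, Complex.ofReal_div, fsum_exp_neg, h hre, div_eq_iff (Complex.exp_ne_zero _), ← h1,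
    expSum_ofReal]
  simp only [exp_neg_pow_eq]

/-- If `f(e^z) = exp (∑ b i * exp (n i * z))`, the variance function of `f` is the second derivative
of the exponent. -/
lemma sigma2_eq_of_eqOn_exp (ha : ExpSummable (fun k => k) a) (hb : ExpSummable n b)
    (h : Set.EqOn (expSum (fun k => k) a) (fun z => Complex.exp (expSum n b z)) {z | z.re < 0})
    {s : ℝ} (hs : 0 < s) :
    (sigma2 a (Real.exp (-s)) : ℂ) = expSum n (fun i => n i * (n i * b i)) (-s : ℝ) := by
  have hre : ((-s : ℝ) : ℂ).re < 0 := by simpa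
  have h1 := (ha.natCast_mul_eq_of_eqOn_exp hb h hre).2
  rw [sigma2, Complex.ofReal_sub, Complex.ofReal_pow, mf_eq_of_eqOn_exp ha hb h hs,
    Complex.ofReal_div, fsum_exp_neg, h hre, sub_eq_iff_eq_add,
    div_eq_iff (Complex.exp_ne_zero _), ← h1, expSum_ofReal]
  simp only [exp_neg_pow_eq, pow_two, mul_assoc]

lemma charfun_eq_of_eqOn_exp (ha : ExpSummable (fun k => k) a) (hb : ExpSummable n b)
    (h : Set.EqOn (expSum (fun k => k) a) (fun z => Complex.exp (expSum n b z)) {z | z.re < 0})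
    {s : ℝ} (hs : 0 < s) (θ : ℝ) :
    charfun a (Real.exp (-s)) θ = Complex.exp
      (expSum n b ((-s : ℝ) + (θ / sigma a (Real.exp (-s)) : ℝ) * Complex.I) -
        expSum n b (-s : ℝ) - (θ / sigma a (Real.exp (-s)) : ℝ) * Complex.I *
          expSum n (fun i => n i * b i) (-s : ℝ)) := by
  set φ : ℝ := θ / sigma a (Real.exp (-s)) with hφ
  have hre : ((-s : ℝ) : ℂ).re < 0 := by simpa
  have hre' : (((-s : ℝ) : ℂ) + φ * Complex.I).re < 0 := by simpa
  rw [← mf_eq_of_eqOn_exp ha hb h hs, Complex.exp_sub, Complex.exp_sub]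
  have e1 := h hre
  have e2 := h hre'
  simp only at e1 e2
  rw [← e1, ← e2, ← fsum_exp_neg]
  unfold expSum charfun
  rw [← tsum_div_const, ← tsum_div_const]
  refine tsum_congr fun k => ?_
  rw [exp_neg_pow_eq, mul_add, Complex.exp_add, div_eq_mul_inv _ (Complex.exp _),
    ← Complex.exp_neg]
  have : Complex.I * θ * (((k - mf a (Real.exp (-s))) / sigma a (Real.exp (-s)) : ℝ) : ℂ) =
      k * (φ * Complex.I) + -(φ * Complex.I * mf a (Real.exp (-s))) := by
    rw [hφ]
    push_cast
    ring
  rw [this, Complex.exp_add]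
  push_cast
  ring

/-- A quantitative central limit theorem for the Khinchin family of `f`, where
`f(e^z) = exp (∑ b i * exp (n i * z))`. -/
lemma norm_log_charfun_add_le (ha : ExpSummable (fun k => k) a) (hb : ExpSummable n b)
    (h : Set.EqOn (expSum (fun k => k) a) (fun z => Complex.exp (expSum n b z)) {z | z.re < 0})
    {s : ℝ} (hs : 0 < s) (hσ : 0 < sigma2 a (Real.exp (-s))) (θ : ℝ) :
    ∃ w : ℂ, charfun a (Real.exp (-s)) θ = Complex.exp (-(θ : ℂ) ^ 2 / 2 + w) ∧
      ‖w‖ ≤ 192 * |θ| ^ 3 / (sigma a (Real.exp (-s)) * s) ^ 3 *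
        ∑' i, |b i| * Real.exp (-(n i * (s / 2))) := by
  set σ := sigma a (Real.exp (-s)) with hσd
  have hσ0 : 0 < σ := Real.sqrt_pos.2 hσ
  refine ⟨_, ?_, (hb.norm_taylor_le hs (θ / σ)).trans_eq ?_⟩
  · rw [charfun_eq_of_eqOn_exp ha hb h hs, ← sigma2_eq_of_eqOn_exp ha hb h hs,
      ← Real.sq_sqrt hσ.le]
    change _ = Complex.exp (_ + (_ + _ * ((σ ^ 2 : ℝ) : ℂ)))
    rw [← hσd]
    have hφ : ((θ / σ : ℝ) : ℂ) ^ 2 * ((σ ^ 2 : ℝ) : ℂ) = (θ : ℂ) ^ 2 := by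
      rw [← Complex.ofReal_pow, ← Complex.ofReal_mul, ← Complex.ofReal_pow]
      congr 1
      field_simp
    congr 1
    linear_combination -hφ / 2
  · rw [abs_div, abs_of_pos hσ0]
    field_simp

end ExpOfExpSum

section PartitionsWithPartsIn

/-- Exponents of the series `log P_A(e^z) = ∑ (k + 1)⁻¹ exp ((k + 1) j z)`. -/
def partExp (A : Set ℕ) (p : ℕ × A) : ℕ := (p.1 + 1) * p.2

/-- Coefficients of the series `log P_A(e^z) = ∑ (k + 1)⁻¹ exp ((k + 1) j z)`. -/
noncomputable def partCoeff (A : Set ℕ) (p : ℕ × A) : ℝ := ((p.1 : ℝ) + 1)⁻¹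

variable {A : Set ℕ}

lemma summable_exp_neg_natCast_mul {y : ℝ} (hy : 0 < y) :
    Summable fun k : ℕ => Real.exp (-(k * y)) := by
  refine (summable_geometric_of_lt_one (Real.exp_pos (-y)).le
    (Real.exp_lt_one_iff.2 (by linarith))).congr fun k => ?_
  rw [exp_neg_pow_eq, mul_neg]

lemma partCoeff_nonneg (p : ℕ × A) : 0 ≤ partCoeff A p := by
  unfold partCoeff
  positivity

lemma expSummable_part (hA : ∀ n ∈ A, 1 ≤ n) : ExpSummable (partExp A) (partCoeff A) := by
  intro s hs
  have h1 := summable_exp_neg_natCast_mul hs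
  refine Summable.of_nonneg_of_le (fun p => by positivity) (fun p => ?_)
    (h1.mul_of_nonneg (h1.comp_injective (Subtype.val_injective (p := (· ∈ A))))
      (fun _ => (Real.exp_pos _).le) (fun _ => (Real.exp_pos _).le))
  obtain ⟨k, j, hj⟩ := p
  have hj1 : (1 : ℝ) ≤ j := by exact_mod_cast hA j hj
  have hk : (0 : ℝ) ≤ k := Nat.cast_nonneg k
  rw [abs_of_nonneg (partCoeff_nonneg _)]
  simp only [partExp, partCoeff, Function.comp]
  rw [← Real.exp_add]
  refine (mul_le_of_le_one_left (Real.exp_pos _).le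
    (inv_le_one_of_one_le₀ (by linarith))).trans (Real.exp_le_exp.2 ?_)
  push_cast
  nlinarith [mul_nonneg (mul_nonneg hk (sub_nonneg.2 hj1)) hs.le]

lemma tsum_exp_neg_natCast_mul_le (hA : ∀ n ∈ A, 1 ≤ n) {y : ℝ} (hy : 0 < y) :
    ∑' j : A, Real.exp (-((j : ℕ) * y)) ≤ 1 / y := by
  have h1 := summable_exp_neg_natCast_mul hy
  have hlt : Real.exp (-y) < 1 := Real.exp_lt_one_iff.2 (by linarith)
  have hgeom := (hasSum_geometric_of_lt_one (Real.exp_pos (-y)).le hlt).mul_left (Real.exp (-y))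
  have hle : ∑' j : A, Real.exp (-((j : ℕ) * y)) ≤
      ∑' k : ℕ, Real.exp (-y) * Real.exp (-y) ^ k := by
    refine Summable.tsum_le_tsum_of_inj (fun j : A => (j : ℕ) - 1) ?_ (fun _ _ => by positivity)
      (fun j => ?_) (h1.comp_injective Subtype.val_injective) hgeom.summable
    · intro i j hij
      have := hA i i.2
      have := hA j j.2
      simp only at hij
      exact Subtype.ext (by omega)
    · rw [← pow_succ', Nat.sub_add_cancel (hA j j.2), exp_neg_pow_eq, mul_neg]
  rw [hgeom.tsum_eq] at hle
  refine hle.trans ?_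
  rw [← div_eq_mul_inv, div_le_div_iff₀ (by linarith) hy]
  have h2 := Real.add_one_le_exp y
  have h3 : Real.exp (-y) * Real.exp y = 1 := by rw [← Real.exp_add]; simp
  nlinarith [Real.exp_pos (-y)]

lemma tsum_part_le (hA : ∀ n ∈ A, 1 ≤ n) {s : ℝ} (hs : 0 < s) :
    ∑' p, |partCoeff A p| * Real.exp (-(partExp A p * s)) ≤
      (∑' k : ℕ, 1 / ((k : ℝ) + 1) ^ 2) / s := by
  have hsum := expSummable_part hA s hs
  rw [hsum.tsum_prod, ← tsum_div_const]
  have hK : Summable fun k : ℕ => 1 / ((k : ℝ) + 1) ^ 2 := by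
    simpa using (summable_nat_add_iff 1).2 (Real.summable_one_div_nat_pow.2 one_lt_two)
  refine Summable.tsum_le_tsum (fun k => ?_) hsum.prod (hK.div_const s)
  have hk : (0 : ℝ) < k + 1 := by positivity
  have := tsum_exp_neg_natCast_mul_le hA (mul_pos hk hs)
  have he : ∀ j : A, |partCoeff A (k, j)| * Real.exp (-(partExp A (k, j) * s)) =
      ((k : ℝ) + 1)⁻¹ * Real.exp (-((j : ℕ) * (((k : ℝ) + 1) * s))) := by
    intro j
    rw [abs_of_nonneg (partCoeff_nonneg _)]
    simp only [partExp, partCoeff]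
    push_cast
    congr 3
    ring
  rw [tsum_congr he, tsum_mul_left]
  calc _ ≤ ((k : ℝ) + 1)⁻¹ * (1 / ((k + 1) * s)) := by gcongr
    _ = _ := by field_simp

lemma hasProd_exp_part (hA : ∀ n ∈ A, 1 ≤ n) {s : ℝ} (hs : 0 < s) :
    HasProd (fun j : A => (1 - Real.exp (-s) ^ (j : ℕ))⁻¹)
      (Real.exp (∑' p, partCoeff A p * Real.exp (partExp A p * -s))) := by
  have hsum : Summable fun p => partCoeff A p * Real.exp (partExp A p * -s) :=
    (expSummable_part hA s hs).congr fun p => by rw [abs_of_nonneg (partCoeff_nonneg p), mul_neg]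
  have h1 := (Equiv.prodComm A ℕ).hasSum_iff.2 hsum.hasSum
  have hlt : ∀ j : A, Real.exp (-s) ^ (j : ℕ) < 1 := fun j =>
    pow_lt_one₀ (Real.exp_pos _).le (Real.exp_lt_one_iff.2 (by linarith))
      (Nat.one_le_iff_ne_zero.1 (hA j j.2))
  have h2 := h1.prod_fiberwise (g := fun j : A => -Real.log (1 - Real.exp (-s) ^ (j : ℕ)))
    fun j => by
      have habs : |Real.exp (-s) ^ (j : ℕ)| < 1 := by
        rw [abs_of_pos (by positivity)]
        exact hlt j
      convert Real.hasSum_pow_div_log_of_abs_lt_one habs using 2 with k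
      simp only [Function.comp, Equiv.prodComm_apply, Prod.swap_prod_mk, partCoeff, partExp]
      rw [← exp_neg_pow_eq, ← pow_mul, mul_comm (k + 1), div_eq_inv_mul]
  refine h2.rexp.congr_fun fun j => ?_
  have := hlt j
  simp only [Function.comp]
  rw [Real.exp_neg (Real.log _), Real.exp_log (by linarith)]

lemma card_filter_lt_mem_ge [DecidablePred (· ∈ A)] (N : ℕ) {c : ℝ} (hc : 0 ≤ c) :
    (((Finset.Icc 1 N).filter (· ∈ A)).card : ℝ) - c ≤
      (((Finset.Icc 1 N).filter (· ∈ A)).filter fun n : ℕ => c < n).card := by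
  have h1 := Finset.card_filter_add_card_filter_not (s := (Finset.Icc 1 N).filter (· ∈ A))
    (fun n : ℕ => c < n)
  have h2 : (((Finset.Icc 1 N).filter (· ∈ A)).filter fun n : ℕ => ¬ c < n).card ≤ ⌊c⌋₊ := by
    refine (Finset.card_le_card (t := Finset.Icc 1 ⌊c⌋₊) fun n hn => ?_).trans (by simp)
    simp only [Finset.mem_filter, Finset.mem_Icc, not_lt] at hn ⊢
    exact ⟨hn.1.1.1, Nat.le_floor hn.2⟩
  have h3 : (((((Finset.Icc 1 N).filter (· ∈ A)).filter fun n : ℕ => ¬ c < n).card : ℕ) : ℝ) ≤ c :=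
    (Nat.cast_le.2 h2).trans (Nat.floor_le hc)
  rw [← h1]
  push_cast
  linarith

lemma le_tsum_sq_part [DecidablePred (· ∈ A)] (hA : ∀ n ∈ A, 1 ≤ n) {s : ℝ} (hs : 0 < s) {N : ℕ}
    (hN : N * s ≤ 1) {c : ℝ} (hc : 0 ≤ c)
    (hcard : 2 * c ≤ ((Finset.Icc 1 N).filter (· ∈ A)).card) :
    c ^ 3 * Real.exp (-1) ≤ ∑' p, (partExp A p * (partExp A p * partCoeff A p)) *
      Real.exp (partExp A p * -s) := by
  set f : ℕ × A → ℝ := fun p => (partExp A p * (partExp A p * partCoeff A p)) *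
      Real.exp (partExp A p * -s)
  have hf0 : ∀ p, 0 ≤ f p := fun p => by
    have := partCoeff_nonneg p
    positivity
  have hf : Summable f := ((expSummable_part hA).natCast_mul.natCast_mul s hs).congr fun p => by
    have := partCoeff_nonneg p
    simp only [f]
    rw [abs_of_nonneg (by positivity), mul_neg]
  have hinj : Function.Injective fun j : A => ((0 : ℕ), j) := fun i j h => by simpa using h
  have hfA := hf.comp_injective hinj
  have h1 : ∑' j : A, f (0, j) ≤ ∑' p, f p :=
    Summable.tsum_le_tsum_of_inj _ hinj (fun p _ => hf0 p) (fun _ => le_rfl) hfA hf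
  set g : ℕ → ℝ := fun j => (j : ℝ) ^ 2 * Real.exp (-(j * s))
  have hg : ∀ j : A, f (0, j) = g j := fun j => by
    simp only [f, g, partExp, partCoeff]
    push_cast
    ring_nf
  have hgA : Summable fun j : A => g j := hfA.congr hg
  rw [tsum_congr hg, tsum_subtype A g] at h1
  refine le_trans ?_ h1
  set F := ((Finset.Icc 1 N).filter (· ∈ A)).filter fun n : ℕ => c < n
  have hFc : c ≤ F.card := by linarith [card_filter_lt_mem_ge (A := A) N hc]
  refine le_trans ?_ (Summable.sum_le_tsum F (fun n _ => Set.indicator_nonneg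
    (fun n _ => by positivity) n) (summable_subtype_iff_indicator.1 hgA))
  have hterm : ∀ n ∈ F, c ^ 2 * Real.exp (-1) ≤ A.indicator g n := by
    intro n hn
    simp only [F, Finset.mem_filter, Finset.mem_Icc] at hn
    rw [Set.indicator_of_mem hn.1.2]
    have hnN : (n : ℝ) ≤ N := by exact_mod_cast hn.1.1.2
    have hn1 : (n : ℝ) * s ≤ 1 := by nlinarith
    have := hn.2.le
    simp only [g]
    gcongr
  calc c ^ 3 * Real.exp (-1) = c * (c ^ 2 * Real.exp (-1)) := by ring
    _ ≤ F.card * (c ^ 2 * Real.exp (-1)) := by gcongr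
    _ ≤ _ := by
      rw [← nsmul_eq_mul]
      exact Finset.card_nsmul_le_sum F _ _ hterm

lemma eventually_le_tsum_sq_part [DecidablePred (· ∈ A)] (hA : ∀ n ∈ A, 1 ≤ n) {d : ℝ} (hd : 0 < d)
    (hdens : Tendsto
      (fun n : ℕ => (((Finset.Icc 1 n).filter (· ∈ A)).card : ℝ) / n) atTop (𝓝 d)) :
    ∀ᶠ s : ℝ in 𝓝[>] 0, (d / 8) ^ 3 * Real.exp (-1) / s ^ 3 ≤
      ∑' p, (partExp A p * (partExp A p * partCoeff A p)) * Real.exp (partExp A p * -s) := by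
  have hfloor : Tendsto (fun s : ℝ => ⌊s⁻¹⌋₊) (𝓝[>] 0) atTop :=
    tendsto_nat_floor_atTop.comp tendsto_inv_nhdsGT_zero
  filter_upwards [hfloor.eventually (hdens.eventually (lt_mem_nhds (half_lt_self hd))),
    self_mem_nhdsWithin, Ioo_mem_nhdsGT (show (0 : ℝ) < 1 / 2 by norm_num)] with s hs hs0 hs1
  have hs0 : 0 < s := hs0
  set N := ⌊s⁻¹⌋₊
  have hN1 : (N : ℝ) ≤ s⁻¹ := Nat.floor_le (by positivity)
  have hN2 : s⁻¹ < N + 1 := Nat.lt_floor_add_one _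
  have hN3 : s⁻¹ / 2 ≤ N := by
    have : (2 : ℝ) ≤ s⁻¹ := by
      rw [le_inv_comm₀ (by norm_num) hs0]
      linarith [hs1.2]
    linarith
  have hNpos : (0 : ℝ) < N := lt_of_lt_of_le (by positivity) hN3
  rw [lt_div_iff₀ hNpos] at hs
  have := le_tsum_sq_part hA hs0 (N := N) ((le_mul_inv_iff₀ hs0).1 (by simpa using hN1))
    (c := d / 8 * s⁻¹) (by positivity) (by nlinarith)
  refine le_trans (le_of_eq ?_) this
  field_simp

end PartitionsWithPartsIn

/-- for a set `A` of positive natural density, the OGF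
`P_A(z) = ∏_{j∈A} (1 - z^j)⁻¹` of partitions with parts in `A` (whose coefficients `a`
are characterized by the product identity on `(0,1)`) is Gaussian. -/
theorem statement16 (A : Set ℕ) [DecidablePred (· ∈ A)] (hA : ∀ n ∈ A, 1 ≤ n)
    (d : ℝ) (hd : 0 < d)
    (hdens : Tendsto
      (fun n : ℕ => (((Finset.Icc 1 n).filter (· ∈ A)).card : ℝ) / n) atTop (𝓝 d))
    (a : ℕ → ℝ)
    (ha : ∀ t : ℝ, 0 < t → t < 1 →
      HasSum (fun n : ℕ => a n * t ^ n) (∏' j : A, (1 - t ^ (j : ℕ))⁻¹)) :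
    IsGaussian a 1 := by
  intro θ
  have hsum : ∀ s : ℝ, 0 < s → HasSum (fun n : ℕ => a n * Real.exp (-s) ^ n)
      (Real.exp (∑' p, partCoeff A p * Real.exp (partExp A p * -s))) := fun s hs => by
    rw [← (hasProd_exp_part hA hs).tprod_eq]
    exact ha _ (Real.exp_pos _) (Real.exp_lt_one_iff.2 (by linarith))
  have ha' : ExpSummable (fun k => k) a := fun s hs => (hsum s hs).summable.abs.congr fun k => by
    rw [abs_mul, exp_neg_pow_eq, Real.abs_exp, mul_neg]
  have hb := expSummable_part hA
  have heq := ha'.eqOn_of_ofReal hb fun s hs => by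
    rw [expSum_ofReal (partExp A), ← Complex.ofReal_exp, ← fsum_exp_neg, fsum, (hsum s hs).tsum_eq]
  set K : ℝ := ∑' k : ℕ, 1 / ((k : ℝ) + 1) ^ 2
  set c : ℝ := (d / 8) ^ 3 * Real.exp (-1)
  have hc : 0 < c := by positivity
  set B : ℝ := 192 * |θ| ^ 3 * (2 * K)
  have hK : 0 ≤ K := tsum_nonneg fun k => by positivity
  have hB : 0 ≤ B := by positivity
  have hev : ∀ᶠ s : ℝ in 𝓝[>] 0, ∃ w : ℂ,
      charfun a (Real.exp (-s)) θ = Complex.exp (-(θ : ℂ) ^ 2 / 2 + w) ∧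
        ‖w‖ ≤ √(B ^ 2 / c ^ 3 * s) := by
    filter_upwards [eventually_le_tsum_sq_part hA hd hdens, self_mem_nhdsWithin] with s h1 hs
    have hs : 0 < s := hs
    have h2 := sigma2_eq_of_eqOn_exp ha' hb heq hs
    rw [expSum_ofReal, Complex.ofReal_inj] at h2
    rw [← h2] at h1
    have hσ : 0 < sigma2 a (Real.exp (-s)) := lt_of_lt_of_le (by positivity) h1
    obtain ⟨w, hw, hle⟩ := norm_log_charfun_add_le ha' hb heq hs hσ θ
    refine ⟨w, hw, hle.trans (Real.le_sqrt_of_sq_le ?_)⟩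
    have hσsq : sigma a (Real.exp (-s)) ^ 2 = sigma2 a (Real.exp (-s)) := Real.sq_sqrt hσ.le
    have hσ0 : 0 < sigma a (Real.exp (-s)) := Real.sqrt_pos.2 hσ
    set σ := sigma a (Real.exp (-s))
    rw [← hσsq] at h1
    have h3 := tsum_part_le hA (half_pos hs)
    calc _ ≤ (192 * |θ| ^ 3 / (σ * s) ^ 3 * (K / (s / 2))) ^ 2 := by
          gcongr
      _ = B ^ 2 / ((σ ^ 2) ^ 3 * s ^ 8) := by
          simp only [B]
          field_simp
      _ ≤ B ^ 2 / ((c / s ^ 3) ^ 3 * s ^ 8) := by gcongr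
      _ = _ := by field_simp
  obtain ⟨w, hw⟩ := hev.choice
  have hw0 : Tendsto w (𝓝[>] 0) (𝓝 0) := by
    refine squeeze_zero_norm' (hw.mono fun s hs => hs.2) ?_
    have : Continuous fun s : ℝ => √(B ^ 2 / c ^ 3 * s) := by fun_prop
    simpa using (this.tendsto 0).mono_left nhdsWithin_le_nhds
  have hlim : Tendsto (fun s : ℝ => charfun a (Real.exp (-s)) θ) (𝓝[>] 0)
      (𝓝 (Complex.exp (-(θ : ℂ) ^ 2 / 2))) := by
    refine Tendsto.congr' (hw.mono fun s hs => hs.1.symm) ?_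
    simpa using (hw0.const_add (-(θ : ℂ) ^ 2 / 2)).cexp
  have hlog : Tendsto (fun t : ℝ => -Real.log t) (𝓝[<] 1) (𝓝[>] 0) := by
    refine tendsto_nhdsWithin_iff.2 ⟨?_, ?_⟩
    · have := (Real.continuousAt_log (one_ne_zero' ℝ)).tendsto.neg
      simpa using this.mono_left nhdsWithin_le_nhds
    · filter_upwards [Ioo_mem_nhdsLT (zero_lt_one' ℝ)] with t ht
      simpa using Real.log_neg ht.1 ht.2
  refine (hlim.comp hlog).congr' ?_
  filter_upwards [Ioo_mem_nhdsLT (zero_lt_one' ℝ)] with t ht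
  simp [Real.exp_log ht.1]

end KhinchinPaper
end

section
/- For each integer k ≥ 2 there exists a constant C_k > 0, depending only on k, with the following property: for every increasing sequence (b_j)_{j≥1} of positive real numbers with Σ_{j=1}^{∞} 1/b_j < +∞, the entire function f(z) = ∏_{j=1}^{∞} (1 + z/b_j) has fulcrum F(s) = Σ_{j=1}^{∞} ln(1 + e^s/b_j) satisfying |F^{(k)}(s)| ≤ C_k · F″(s) for every s ∈ ℝ. -/
open scoped BigOperators Topology
open Filter

namespace KhinchinPaper

open Polynomial in
/-- The polynomials `P n` with `g⁽ⁿ⁾ = (P n)(g)` for every solution `g` of the logistic equation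
`g' = g (1 - g)`. -/
noncomputable def logisticPoly : ℕ → ℝ[X]
  | 0 => X
  | n + 1 => derivative (logisticPoly n) * (X * (1 - X))

lemma X_dvd_logisticPoly (n : ℕ) : Polynomial.X ∣ logisticPoly n := by
  cases n with
  | zero => exact dvd_rfl
  | succ n => exact Dvd.dvd.mul_left (dvd_mul_right _ _) _

lemma exists_abs_eval_le_of_dvd {P Q : Polynomial ℝ} (h : P ∣ Q) :
    ∃ C : ℝ, 0 < C ∧ ∀ x ∈ Set.Icc (0 : ℝ) 1, |Q.eval x| ≤ C * |P.eval x| := by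
  obtain ⟨R, rfl⟩ := h
  obtain ⟨C, hC⟩ := (isCompact_Icc (a := (0 : ℝ)) (b := 1)).exists_bound_of_continuousOn
    (f := fun x => R.eval x) R.continuous.continuousOn
  refine ⟨max C 1, by positivity, fun x hx => ?_⟩
  rw [Polynomial.eval_mul, abs_mul, mul_comm]
  gcongr
  exact (hC x hx).trans (le_max_left _ _)

/-- The logistic function `e^u / (b + e^u)`. -/
noncomputable def logistic (b u : ℝ) : ℝ := Real.exp u / (b + Real.exp u)

lemma logistic_mem_Icc {b : ℝ} (hb : 0 < b) (u : ℝ) : logistic b u ∈ Set.Icc (0 : ℝ) 1 := by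
  have := Real.exp_pos u
  refine ⟨by unfold logistic; positivity, ?_⟩
  unfold logistic
  rw [div_le_one (by positivity)]
  linarith

lemma logistic_le_exp_div {b : ℝ} (hb : 0 < b) (u : ℝ) : logistic b u ≤ Real.exp u / b := by
  have := Real.exp_pos u
  unfold logistic
  gcongr
  linarith

lemma hasDerivAt_log_one_add_exp_div {b : ℝ} (hb : 0 < b) (u : ℝ) :
    HasDerivAt (fun u => Real.log (1 + Real.exp u / b)) (logistic b u) u := by
  have := Real.exp_pos u
  have h := (((Real.hasDerivAt_exp u).div_const b).const_add 1).log (by positivity)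
  refine h.congr_deriv ?_
  unfold logistic
  field_simp

lemma hasDerivAt_logistic {b : ℝ} (hb : 0 < b) (u : ℝ) :
    HasDerivAt (logistic b) (logistic b u * (1 - logistic b u)) u := by
  have := Real.exp_pos u
  have h := (Real.hasDerivAt_exp u).div ((Real.hasDerivAt_exp u).const_add b) (by positivity)
  refine h.congr_deriv ?_
  unfold logistic
  field_simp

lemma hasDerivAt_eval_logisticPoly {b : ℝ} (hb : 0 < b) (n : ℕ) (u : ℝ) :
    HasDerivAt (fun u => (logisticPoly n).eval (logistic b u))
      ((logisticPoly (n + 1)).eval (logistic b u)) u := by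
  have h := ((logisticPoly n).hasDerivAt (logistic b u)).comp u (hasDerivAt_logistic hb u)
  simpa [logisticPoly, Function.comp_def] using h

lemma summable_mul_exp_div {b : ℕ → ℝ} (hs : Summable fun j => 1 / b j) (C u : ℝ) :
    Summable fun j => C * (Real.exp u / b j) := by
  simpa [div_eq_mul_inv, mul_assoc] using hs.mul_left (C * Real.exp u)

lemma hasDerivAt_tsum_of_le_exp {b : ℕ → ℝ} (hb : ∀ j, 0 < b j)
    (hs : Summable fun j => 1 / b j) {f f' : ℕ → ℝ → ℝ} {C : ℝ} (hC : 0 ≤ C)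
    (hf : ∀ j u, HasDerivAt (f j) (f' j u) u) (hf' : ∀ j u, |f' j u| ≤ C * (Real.exp u / b j))
    {u : ℝ} (hsum : Summable fun j => f j u) :
    HasDerivAt (fun u => ∑' j, f j u) (∑' j, f' j u) u := by
  have hu : u ∈ Set.Iio (u + 1) := by simp
  refine hasDerivAt_tsum_of_isPreconnected (summable_mul_exp_div hs C (u + 1)) isOpen_Iio
    isPreconnected_Iio (fun j y _ => hf j y) (fun j y hy => (hf' j y).trans ?_) hu hsum hu
  have := hb j
  have : y ≤ u + 1 := le_of_lt hy
  gcongr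

lemma exists_abs_eval_logisticPoly_le {b : ℕ → ℝ} (hb : ∀ j, 0 < b j) (n : ℕ) :
    ∃ C : ℝ, 0 < C ∧ ∀ j u, |(logisticPoly n).eval (logistic (b j) u)| ≤
      C * (Real.exp u / b j) := by
  obtain ⟨C, hC, h⟩ := exists_abs_eval_le_of_dvd (X_dvd_logisticPoly n)
  refine ⟨C, hC, fun j u => ?_⟩
  have hm := logistic_mem_Icc (hb j) u
  refine (h _ hm).trans ?_
  rw [Polynomial.eval_X, abs_of_nonneg hm.1]
  gcongr
  exact logistic_le_exp_div (hb j) u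

lemma summable_eval_logisticPoly {b : ℕ → ℝ} (hb : ∀ j, 0 < b j)
    (hs : Summable fun j => 1 / b j) (n : ℕ) (u : ℝ) :
    Summable fun j => (logisticPoly n).eval (logistic (b j) u) := by
  obtain ⟨C, -, h⟩ := exists_abs_eval_logisticPoly_le hb n
  exact Summable.of_norm_bounded (summable_mul_exp_div hs C u) fun j => h j u

lemma iteratedDeriv_tsum_log {b : ℕ → ℝ} (hb : ∀ j, 0 < b j)
    (hs : Summable fun j => 1 / b j) (n : ℕ) :
    iteratedDeriv (n + 1) (fun u : ℝ => ∑' j, Real.log (1 + Real.exp u / b j)) =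
      fun u => ∑' j, (logisticPoly n).eval (logistic (b j) u) := by
  induction n with
  | zero =>
    rw [zero_add, iteratedDeriv_one]
    funext u
    simp only [logisticPoly, Polynomial.eval_X]
    refine (hasDerivAt_tsum_of_le_exp hb hs zero_le_one
      (fun j u => hasDerivAt_log_one_add_exp_div (hb j) u) (fun j u => ?_) ?_).deriv
    · rw [abs_of_nonneg (logistic_mem_Icc (hb j) u).1, one_mul]
      exact logistic_le_exp_div (hb j) u
    · refine Real.summable_log_one_add_of_summable ?_
      simpa using summable_mul_exp_div hs 1 u
  | succ n ih =>
    rw [iteratedDeriv_succ, ih]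
    funext u
    obtain ⟨C, hC, h⟩ := exists_abs_eval_logisticPoly_le hb (n + 1)
    exact (hasDerivAt_tsum_of_le_exp hb hs hC.le
      (fun j u => hasDerivAt_eval_logisticPoly (hb j) n u) h
      (summable_eval_logisticPoly hb hs n u)).deriv

/-- for each `k ≥ 2` there is `C_k > 0`, depending only on `k`, such that
for every canonical product `f(z) = ∏ (1 + z/b_j)` of genus 0 with negative zeros, the
fulcrum `F(s) = ∑ ln(1 + e^s/b_j)` satisfies `|F^{(k)}(s)| ≤ C_k F''(s)` for all `s`. -/
theorem statement17 (k : ℕ) (hk : 2 ≤ k) :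
    ∃ C : ℝ, 0 < C ∧
      ∀ b : ℕ → ℝ, (∀ j, 0 < b j) → Monotone b → (Summable fun j => 1 / b j) →
        ∀ s : ℝ,
          |iteratedDeriv k (fun u : ℝ => ∑' j : ℕ, Real.log (1 + Real.exp u / b j)) s| ≤
            C * iteratedDeriv 2 (fun u : ℝ => ∑' j : ℕ, Real.log (1 + Real.exp u / b j)) s := by
  obtain ⟨n, rfl⟩ := Nat.exists_eq_add_of_le' hk
  have hdvd : logisticPoly 1 ∣ logisticPoly (n + 1) := by
    simp [logisticPoly]
  obtain ⟨C, hC, h⟩ := exists_abs_eval_le_of_dvd hdvd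
  refine ⟨C, hC, fun b hb _ hs s => ?_⟩
  rw [iteratedDeriv_tsum_log hb hs (n + 1), iteratedDeriv_tsum_log hb hs 1, ← tsum_mul_left]
  refine tsum_of_norm_bounded (E := ℝ) ((summable_eval_logisticPoly hb hs 1 s).mul_left C).hasSum
    fun j => ?_
  have hm := logistic_mem_Icc (hb j) s
  refine (h _ hm).trans_eq ?_
  have : 0 ≤ (logisticPoly 1).eval (logistic (b j) s) := by
    simpa [logisticPoly] using mul_nonneg hm.1 (sub_nonneg.2 hm.2)
  rw [abs_of_nonneg this]

end KhinchinPaper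
end

section
/- Let f ∈ 𝒬, i.e. f(z) = ∏_{j=1}^{∞} (1 + z/b_j) with (b_j) an increasing sequence of positive reals satisfying Σ 1/b_j < +∞ (an entire function of genus 0 in 𝒦 with only negative zeros and f(0)=1). If lim_{t→+∞} σ_f²(t) = +∞, then f is Gaussian: its normalized Khinchin family X̆_t converges in distribution to the standard normal N(0,1) as t → +∞. -/
open scoped BigOperators Topology
open Filter

namespace KhinchinPaper

/-- Multiplying the coefficients of an entire power series by `n` keeps it entire. -/
lemma summable_norm_nat_mul {c : ℕ → ℂ} (hc : ∀ r : ℝ, 0 ≤ r → Summable fun n => ‖c n‖ * r ^ n)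
    (r : ℝ) (hr : 0 ≤ r) : Summable fun n : ℕ => ‖(n : ℂ) * c n‖ * r ^ n := by
  refine (hc (2 * r) (by positivity)).of_nonneg_of_le (fun n => by positivity) fun n => ?_
  have h : (n : ℝ) ≤ 2 ^ n := mod_cast n.lt_two_pow_self.le
  rw [norm_mul, Complex.norm_natCast, mul_pow]
  calc (n : ℝ) * ‖c n‖ * r ^ n = n * (‖c n‖ * r ^ n) := by ring
    _ ≤ 2 ^ n * (‖c n‖ * r ^ n) := by gcongr
    _ = ‖c n‖ * (2 ^ n * r ^ n) := by ring

lemma norm_mul_pow_le_of_mem_ball {c : ℕ → ℂ} {r : ℝ} (n : ℕ) {w : ℂ}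
    (hw : w ∈ Metric.ball (0 : ℂ) r) : ‖c n * w ^ n‖ ≤ ‖c n‖ * r ^ n := by
  rw [norm_mul, norm_pow]
  gcongr
  exact (mem_ball_zero_iff.1 hw).le

lemma differentiable_powerSeries {c : ℕ → ℂ}
    (hc : ∀ r : ℝ, 0 ≤ r → Summable fun n => ‖c n‖ * r ^ n) :
    Differentiable ℂ fun z : ℂ => ∑' n, c n * z ^ n := by
  intro z
  have hz : z ∈ Metric.ball (0 : ℂ) (‖z‖ + 1) := by simp
  exact (Complex.differentiableOn_tsum_of_summable_norm (hc (‖z‖ + 1) (by positivity))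
    (fun n => by fun_prop) Metric.isOpen_ball
    fun n w hw => norm_mul_pow_le_of_mem_ball n hw).differentiableAt
    (Metric.isOpen_ball.mem_nhds hz)

lemma tsum_nat_mul_eq_mul_deriv {c : ℕ → ℂ}
    (hc : ∀ r : ℝ, 0 ≤ r → Summable fun n => ‖c n‖ * r ^ n) (z : ℂ) :
    ∑' n : ℕ, (n : ℂ) * c n * z ^ n = z * deriv (fun z : ℂ => ∑' n, c n * z ^ n) z := by
  have hz : z ∈ Metric.ball (0 : ℂ) (‖z‖ + 1) := by simp
  have h := Complex.hasSum_deriv_of_summable_norm (hc (‖z‖ + 1) (by positivity))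
    (F := fun n w => c n * w ^ n) (fun n => by fun_prop) Metric.isOpen_ball
    (fun n w hw => norm_mul_pow_le_of_mem_ball n hw) hz
  rw [← (h.mul_left z).tsum_eq]
  refine tsum_congr fun n => ?_
  cases n with
  | zero => simp
  | succ n =>
    simp only [deriv_const_mul_field', deriv_pow_field, Nat.add_sub_cancel]
    ring

/-- The canonical product `∏ (1 + z / b j)`. -/
noncomputable def canonicalProduct (b : ℕ → ℝ) (z : ℂ) : ℂ := ∏' j, (1 + z / b j)

section CanonicalProduct

variable {b : ℕ → ℝ}

lemma norm_div_le_of_mem_ball (hb : ∀ j, 0 < b j) (j : ℕ) {z : ℂ} {r : ℝ}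
    (hz : z ∈ Metric.ball (0 : ℂ) r) : ‖z / b j‖ ≤ r * (1 / b j) := by
  have := hb j
  rw [norm_div, Complex.norm_real, Real.norm_of_nonneg this.le, div_eq_mul_one_div]
  gcongr
  exact (mem_ball_zero_iff.1 hz).le

lemma summable_norm_div (hb : ∀ j, 0 < b j) (hsum : Summable fun j => 1 / b j) (z : ℂ) :
    Summable fun j => ‖z / b j‖ :=
  (hsum.mul_left (‖z‖ + 1)).of_nonneg_of_le (fun _ => norm_nonneg _) fun j =>
    norm_div_le_of_mem_ball hb j (by simp)

lemma hasProd_canonicalProduct (hb : ∀ j, 0 < b j) (hsum : Summable fun j => 1 / b j) (z : ℂ) :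
    HasProd (fun j => 1 + z / b j) (canonicalProduct b z) :=
  (multipliable_one_add_of_summable (summable_norm_div hb hsum z)).hasProd

lemma hasProdLocallyUniformlyOn_canonicalProduct (hb : ∀ j, 0 < b j)
    (hsum : Summable fun j => 1 / b j) (r : ℝ) :
    HasProdLocallyUniformlyOn (fun j (z : ℂ) => 1 + z / b j) (canonicalProduct b)
      (Metric.ball 0 r) :=
  Summable.hasProdLocallyUniformlyOn_one_add Metric.isOpen_ball (hsum.mul_left r)
    (.of_forall fun j _ hz => norm_div_le_of_mem_ball hb j hz) fun j => by fun_prop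

lemma differentiable_canonicalProduct (hb : ∀ j, 0 < b j) (hsum : Summable fun j => 1 / b j) :
    Differentiable ℂ (canonicalProduct b) := by
  intro z
  have hz : z ∈ Metric.ball (0 : ℂ) (‖z‖ + 1) := by simp
  refine (TendstoLocallyUniformlyOn.differentiableOn
    (hasProdLocallyUniformlyOn_canonicalProduct hb hsum (‖z‖ + 1)) (.of_forall fun s => ?_)
    Metric.isOpen_ball).differentiableAt (Metric.isOpen_ball.mem_nhds hz)
  fun_prop

lemma add_ne_zero_of_re_pos (hb : ∀ j, 0 < b j) {z : ℂ} (hz : 0 < z.re) (j : ℕ) :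
    (b j : ℂ) + z ≠ 0 := by
  intro h
  have := congrArg Complex.re h
  simp at this
  linarith [hb j]

lemma one_add_div_ne_zero_of_re_pos (hb : ∀ j, 0 < b j) {z : ℂ} (hz : 0 < z.re) (j : ℕ) :
    1 + z / b j ≠ 0 := by
  have h : (b j : ℂ) ≠ 0 := mod_cast (hb j).ne'
  rw [one_add_div h]
  exact div_ne_zero (add_ne_zero_of_re_pos hb hz j) h

lemma canonicalProduct_ne_zero (hb : ∀ j, 0 < b j) (hsum : Summable fun j => 1 / b j) {z : ℂ}
    (hz : 0 < z.re) : canonicalProduct b z ≠ 0 :=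
  tprod_one_add_ne_zero_of_summable (one_add_div_ne_zero_of_re_pos hb hz)
    (summable_norm_div hb hsum z)

lemma norm_div_add_le (hb : ∀ j, 0 < b j) (j : ℕ) {z : ℂ} {r : ℝ}
    (hz : 0 < z.re) (hr : z ∈ Metric.ball (0 : ℂ) r) : ‖z / (b j + z)‖ ≤ r * (1 / b j) := by
  have hj := hb j
  have h : b j ≤ ‖(b j : ℂ) + z‖ := by
    refine le_trans ?_ (Complex.re_le_norm _)
    simp [hz.le]
  rw [norm_div, div_eq_mul_one_div]
  gcongr
  · exact (norm_nonneg z).trans (mem_ball_zero_iff.1 hr).le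
  · exact (mem_ball_zero_iff.1 hr).le

lemma summable_div_add (hb : ∀ j, 0 < b j) (hsum : Summable fun j => 1 / b j) {z : ℂ}
    (hz : 0 < z.re) : Summable fun j => z / (b j + z) :=
  (hsum.mul_left (‖z‖ + 1)).of_norm_bounded fun j => norm_div_add_le hb j hz (by simp)

lemma mul_deriv_canonicalProduct (hb : ∀ j, 0 < b j) (hsum : Summable fun j => 1 / b j) {z : ℂ}
    (hz : 0 < z.re) :
    z * deriv (canonicalProduct b) z = canonicalProduct b z * ∑' j, z / (b j + z) := by
  have hz0 : z ≠ 0 := by rintro rfl; simp at hz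
  have hzr : z ∈ Metric.ball (0 : ℂ) (‖z‖ + 1) := by simp
  have hterm (j : ℕ) : logDeriv (fun w : ℂ => 1 + w / b j) z = z⁻¹ * (z / (b j + z)) := by
    have h₁ : (b j : ℂ) ≠ 0 := mod_cast (hb j).ne'
    have h₂ := add_ne_zero_of_re_pos hb hz j
    have h₃ := one_add_div_ne_zero_of_re_pos hb hz j
    rw [logDeriv_apply]
    have hd : HasDerivAt (fun w : ℂ => 1 + w / b j) (1 / b j) z :=
      ((hasDerivAt_id z).div_const _).const_add _
    rw [hd.deriv]
    field_simp
  have hne := canonicalProduct_ne_zero hb hsum hz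
  have h := logDeriv_tprod_eq_tsum (f := fun j (w : ℂ) => 1 + w / b j)
    Metric.isOpen_ball hzr (one_add_div_ne_zero_of_re_pos hb hz) (fun j => by fun_prop)
    (by simpa only [hterm] using (summable_div_add hb hsum hz).mul_left z⁻¹)
    ⟨_, hasProdLocallyUniformlyOn_canonicalProduct hb hsum (‖z‖ + 1)⟩ hne
  simp only [hterm, tsum_mul_left] at h
  change logDeriv (canonicalProduct b) z = _ at h
  rw [logDeriv_apply, div_eq_iff hne] at h
  rw [h]
  field_simp

lemma isOpen_re_pos_inter_ball (r : ℝ) : IsOpen ({z : ℂ | 0 < z.re} ∩ Metric.ball 0 r) :=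
  (isOpen_lt continuous_const Complex.continuous_re).inter Metric.isOpen_ball

lemma differentiableAt_tsum_div_add (hb : ∀ j, 0 < b j) (hsum : Summable fun j => 1 / b j)
    {z : ℂ} (hz : 0 < z.re) :
    DifferentiableAt ℂ (fun w : ℂ => ∑' j, w / (b j + w)) z := by
  have hzr : z ∈ {z : ℂ | 0 < z.re} ∩ Metric.ball 0 (‖z‖ + 1) := ⟨hz, by simp⟩
  refine (Complex.differentiableOn_tsum_of_summable_norm (hsum.mul_left (‖z‖ + 1)) (fun j => ?_)
    (isOpen_re_pos_inter_ball _) fun j w hw => norm_div_add_le hb j hw.1 hw.2).differentiableAt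
    ((isOpen_re_pos_inter_ball _).mem_nhds hzr)
  exact fun w hw => (DifferentiableAt.div (by fun_prop) (by fun_prop)
    (add_ne_zero_of_re_pos hb hw.1 j)).differentiableWithinAt

lemma hasSum_mul_deriv_tsum_div_add (hb : ∀ j, 0 < b j) (hsum : Summable fun j => 1 / b j)
    {z : ℂ} (hz : 0 < z.re) :
    HasSum (fun j => z / (b j + z) * (1 - z / (b j + z)))
      (z * deriv (fun w : ℂ => ∑' j, w / (b j + w)) z) := by
  have hzr : z ∈ {z : ℂ | 0 < z.re} ∩ Metric.ball 0 (‖z‖ + 1) := ⟨hz, by simp⟩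
  have h := Complex.hasSum_deriv_of_summable_norm (F := fun j w => w / (b j + w))
    (hsum.mul_left (‖z‖ + 1)) (fun j w hw => (DifferentiableAt.div (by fun_prop) (by fun_prop)
    (add_ne_zero_of_re_pos hb hw.1 j)).differentiableWithinAt)
    (isOpen_re_pos_inter_ball _) (fun j w hw => norm_div_add_le hb j hw.1 hw.2) hzr
  refine (h.mul_left z).congr_fun fun j => ?_
  have h₂ := add_ne_zero_of_re_pos hb hz j
  have hd : HasDerivAt (fun w : ℂ => w / (b j + w))
      ((1 * ((b j : ℂ) + z) - z * 1) / ((b j : ℂ) + z) ^ 2) z :=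
    (hasDerivAt_id z).div ((hasDerivAt_id z).const_add _) h₂
  rw [hd.deriv]
  field_simp

end CanonicalProduct

lemma norm_prod_sub_prod_le {ι : Type*} (s : Finset ι) {w v : ι → ℂ}
    (hw : ∀ i, ‖w i‖ ≤ 1) (hv : ∀ i, ‖v i‖ ≤ 1) :
    ‖∏ i ∈ s, w i - ∏ i ∈ s, v i‖ ≤ ∑ i ∈ s, ‖w i - v i‖ := by
  classical
  induction s using Finset.induction_on with
  | empty => simp
  | insert i s hi ih =>
    rw [Finset.prod_insert hi, Finset.prod_insert hi, Finset.sum_insert hi]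
    have hp : ‖∏ i ∈ s, v i‖ ≤ 1 := by
      rw [norm_prod]
      exact Finset.prod_le_one (fun _ _ => norm_nonneg _) fun j _ => hv j
    calc _ = ‖(w i - v i) * ∏ i ∈ s, v i + w i * (∏ i ∈ s, w i - ∏ i ∈ s, v i)‖ := by ring_nf
      _ ≤ ‖w i - v i‖ * ‖∏ i ∈ s, v i‖ + ‖w i‖ * ‖∏ i ∈ s, w i - ∏ i ∈ s, v i‖ := by
        rw [← norm_mul, ← norm_mul]
        exact norm_add_le _ _
      _ ≤ ‖w i - v i‖ * 1 + 1 * ∑ i ∈ s, ‖w i - v i‖ := by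
        gcongr
        exact hw i
      _ = _ := by ring

/-- The characteristic function of a centred Bernoulli variable with parameter `p`. -/
noncomputable def bernoulliCharfun (p x : ℝ) : ℂ :=
  (1 - p + p * Complex.exp (Complex.I * x)) * Complex.exp (-(Complex.I * x * p))

lemma bernoulliCharfun_div_add {β t : ℝ} (hβ : 0 < β) (ht : 0 < t) (x : ℝ) :
    bernoulliCharfun (t / (β + t)) x =
      (1 + t * Complex.exp (Complex.I * x) / β) / (1 + t / β) *
        Complex.exp (-(Complex.I * x) * (t / (β + t) : ℝ)) := by
  have h₁ : (β : ℂ) ≠ 0 := mod_cast hβ.ne'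
  have h₂ : (β : ℂ) + t ≠ 0 := mod_cast (add_pos hβ ht).ne'
  rw [bernoulliCharfun, neg_mul]
  congr 1
  rw [one_add_div h₁, one_add_div h₁, div_div_div_cancel_right₀ h₁, eq_div_iff h₂]
  push_cast
  field_simp
  ring

lemma norm_bernoulliCharfun_le {p : ℝ} (h₀ : 0 ≤ p) (h₁ : p ≤ 1) (x : ℝ) :
    ‖bernoulliCharfun p x‖ ≤ 1 := by
  have e₁ : ‖Complex.exp (Complex.I * x)‖ = 1 := by
    simp [Complex.norm_exp]
  have e₂ : ‖Complex.exp (-(Complex.I * x * p))‖ = 1 := by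
    simp [Complex.norm_exp]
  rw [bernoulliCharfun, norm_mul, e₂, mul_one]
  calc _ ≤ ‖((1 - p : ℝ) : ℂ)‖ + ‖(p : ℂ) * Complex.exp (Complex.I * x)‖ := by
        simpa using norm_add_le ((1 - p : ℝ) : ℂ) ((p : ℂ) * Complex.exp (Complex.I * x))
    _ = 1 := by
        rw [norm_mul, e₁, Complex.norm_real, Complex.norm_real, Real.norm_of_nonneg h₀,
          Real.norm_of_nonneg (sub_nonneg.2 h₁)]
        ring

lemma norm_exp_I_mul_sub_le {y : ℝ} (hy : |y| ≤ 1) :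
    ‖Complex.exp (Complex.I * y) - (1 + Complex.I * y - y ^ 2 / 2)‖ ≤ |y| ^ 3 := by
  have hn : ‖Complex.I * (y : ℂ)‖ = |y| := by simp
  have h := Complex.exp_bound (x := Complex.I * y) (n := 3) (by rwa [hn]) (by norm_num)
  rw [hn] at h
  have e : ∑ m ∈ Finset.range 3, (Complex.I * (y : ℂ)) ^ m / m.factorial
      = 1 + Complex.I * y - y ^ 2 / 2 := by
    simp [Finset.sum_range_succ, mul_pow, Nat.factorial]
    ring
  rw [e] at h
  refine h.trans ?_
  have : (0 : ℝ) ≤ |y| ^ 3 := by positivity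
  norm_num [Nat.factorial]
  linarith

lemma norm_bernoulliCharfun_sub_le {p x : ℝ} (h₀ : 0 ≤ p) (h₁ : p ≤ 1) (hx : |x| ≤ 1) :
    ‖bernoulliCharfun p x - Complex.exp ((-(x ^ 2 / 2 * (p * (1 - p))) : ℝ) : ℂ)‖
      ≤ 2 * |x| ^ 3 * (p * (1 - p)) := by
  have hq₀ : 0 ≤ 1 - p := by linarith
  have hq₁ : 1 - p ≤ 1 := by linarith
  set q := 1 - p with hq
  have ax : (0 : ℝ) ≤ |x| := abs_nonneg x
  have hy₁ : |(-(x * p))| ≤ 1 := by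
    rw [abs_neg, abs_mul, abs_of_nonneg h₀]; nlinarith
  have hy₂ : |x * q| ≤ 1 := by
    rw [abs_mul, abs_of_nonneg hq₀]; nlinarith
  have t₁ := norm_exp_I_mul_sub_le hy₁
  have t₂ := norm_exp_I_mul_sub_le hy₂
  rw [abs_neg, abs_mul, abs_of_nonneg h₀] at t₁
  rw [abs_mul, abs_of_nonneg hq₀] at t₂
  have hpq₀ : 0 ≤ p * q := mul_nonneg h₀ hq₀
  have hpq₁ : p * q ≤ 1 := by nlinarith
  have hx2 : x ^ 2 ≤ 1 := by rw [← sq_abs]; nlinarith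
  have hs₀ : 0 ≤ x ^ 2 / 2 * (p * q) := by positivity
  have hs₁ : x ^ 2 / 2 * (p * q) ≤ 1 := by nlinarith
  have t₃ := Real.norm_exp_sub_one_sub_id_le (x := -(x ^ 2 / 2 * (p * q)))
    (by rw [norm_neg, Real.norm_of_nonneg hs₀]; exact hs₁)
  rw [norm_neg, Real.norm_of_nonneg hs₀, ← Complex.norm_real] at t₃
  set E₁ := Complex.exp (Complex.I * (-(x * p) : ℝ)) - (1 + Complex.I * (-(x * p) : ℝ)
    - ((-(x * p) : ℝ) : ℂ) ^ 2 / 2) with hE₁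
  set E₂ := Complex.exp (Complex.I * (x * q : ℝ)) - (1 + Complex.I * (x * q : ℝ)
    - ((x * q : ℝ) : ℂ) ^ 2 / 2) with hE₂
  set E₃ := ((Real.exp (-(x ^ 2 / 2 * (p * q))) - 1 - -(x ^ 2 / 2 * (p * q)) : ℝ) : ℂ) with hE₃
  have key : bernoulliCharfun p x - Complex.exp ((-(x ^ 2 / 2 * (p * q)) : ℝ) : ℂ)
      = q * E₁ + p * E₂ - E₃ := by
    have hb : bernoulliCharfun p x = q * Complex.exp (Complex.I * (-(x * p) : ℝ))
        + p * Complex.exp (Complex.I * (x * q : ℝ)) := by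
      rw [bernoulliCharfun, add_mul, mul_assoc (p : ℂ), ← Complex.exp_add]
      congr 2
      · simp [hq]
      · congr 1; push_cast; ring
      · congr 1; simp [hq]; ring
    rw [hb, hE₁, hE₂, hE₃, hq]
    push_cast
    ring_nf
  rw [key]
  calc _ ≤ ‖(q : ℂ) * E₁‖ + ‖(p : ℂ) * E₂‖ + ‖E₃‖ :=
        (norm_sub_le _ _).trans (by gcongr; exact norm_add_le _ _)
    _ ≤ q * (|x| * p) ^ 3 + p * (|x| * q) ^ 3 + (x ^ 2 / 2 * (p * q)) ^ 2 := by
        rw [norm_mul, norm_mul, Complex.norm_real, Complex.norm_real, Real.norm_of_nonneg h₀,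
          Real.norm_of_nonneg hq₀]
        gcongr
    _ = |x| ^ 3 * (p * q) * (p ^ 2 + q ^ 2 + |x| * (p * q) / 4) := by
        rw [← sq_abs x]; ring
    _ ≤ |x| ^ 3 * (p * q) * 2 := by
        gcongr
        have : |x| * (p * q) ≤ 1 := by nlinarith
        nlinarith
    _ = _ := by ring

section Coefficients

variable {a b : ℕ → ℝ}

lemma summable_norm_ofReal (ha : ∀ t : ℝ, 0 ≤ t → Summable fun n => a n * t ^ n) (r : ℝ)
    (hr : 0 ≤ r) : Summable fun n => ‖(a n : ℂ)‖ * r ^ n := by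
  refine (ha r hr).norm.congr fun n => ?_
  rw [norm_mul, Complex.norm_real, Real.norm_of_nonneg (pow_nonneg hr n)]

lemma ofReal_tprod_eq_canonicalProduct (hsum : Summable fun j => 1 / b j)
    (t : ℝ) : ((∏' j, (1 + t / b j) : ℝ) : ℂ) = canonicalProduct b t := by
  have hs : Summable fun j => t / b j := by
    simpa only [mul_one_div] using hsum.mul_left t
  have h := (Real.multipliable_one_add_of_summable hs).hasProd.map Complex.ofRealHom
    Complex.continuous_ofReal
  refine h.tprod_eq.symm.trans (tprod_congr fun j => ?_)
  simp

lemma tsum_mul_pow_eq_canonicalProduct (hb : ∀ j, 0 < b j) (hsum : Summable fun j => 1 / b j)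
    (ha : ∀ t : ℝ, 0 ≤ t → HasSum (fun n : ℕ => a n * t ^ n) (∏' j : ℕ, (1 + t / b j))) :
    (fun z : ℂ => ∑' n, (a n : ℂ) * z ^ n) = canonicalProduct b := by
  have hc := summable_norm_ofReal fun t ht => (ha t ht).summable
  refine AnalyticOnNhd.eq_of_frequently_eq (𝕜 := ℂ) (z₀ := 0)
    (fun z _ => (differentiable_powerSeries hc).analyticAt z)
    (fun z _ => (differentiable_canonicalProduct hb hsum).analyticAt z) ?_
  have ht : Tendsto (fun t : ℝ => (t : ℂ)) (𝓝[>] 0) (𝓝[≠] 0) := by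
    refine tendsto_nhdsWithin_iff.2 ⟨?_, ?_⟩
    · exact (Complex.continuous_ofReal.tendsto' 0 0 (by simp)).mono_left nhdsWithin_le_nhds
    · filter_upwards [self_mem_nhdsWithin] with t ht
      exact Complex.ofReal_ne_zero.2 (ne_of_gt ht)
  refine ht.frequently (Eventually.frequently ?_)
  filter_upwards [self_mem_nhdsWithin] with t ht
  rw [← ofReal_tprod_eq_canonicalProduct hsum, ← (ha t (le_of_lt ht)).tsum_eq]
  push_cast
  rfl

lemma ofReal_fsum (hb : ∀ j, 0 < b j) (hsum : Summable fun j => 1 / b j)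
    (ha : ∀ t : ℝ, 0 ≤ t → HasSum (fun n : ℕ => a n * t ^ n) (∏' j : ℕ, (1 + t / b j)))
    (t : ℝ) : (fsum a t : ℂ) = canonicalProduct b t := by
  rw [← tsum_mul_pow_eq_canonicalProduct hb hsum ha, fsum]
  push_cast
  rfl

lemma tsum_nat_mul_pow_eq (hb : ∀ j, 0 < b j) (hsum : Summable fun j => 1 / b j)
    (ha : ∀ t : ℝ, 0 ≤ t → HasSum (fun n : ℕ => a n * t ^ n) (∏' j : ℕ, (1 + t / b j)))
    {z : ℂ} (hz : 0 < z.re) :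
    ∑' n : ℕ, (n : ℂ) * a n * z ^ n = canonicalProduct b z * ∑' j, z / (b j + z) := by
  rw [tsum_nat_mul_eq_mul_deriv (summable_norm_ofReal fun t ht => (ha t ht).summable),
    tsum_mul_pow_eq_canonicalProduct hb hsum ha, mul_deriv_canonicalProduct hb hsum hz]

lemma tsum_nat_sq_mul_pow_eq (hb : ∀ j, 0 < b j) (hsum : Summable fun j => 1 / b j)
    (ha : ∀ t : ℝ, 0 ≤ t → HasSum (fun n : ℕ => a n * t ^ n) (∏' j : ℕ, (1 + t / b j)))
    {z : ℂ} (hz : 0 < z.re) :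
    ∑' n : ℕ, (n : ℂ) ^ 2 * a n * z ^ n = canonicalProduct b z *
      ((∑' j, z / (b j + z)) ^ 2 + ∑' j, z / (b j + z) * (1 - z / (b j + z))) := by
  have hc := summable_norm_nat_mul
    (summable_norm_ofReal fun t ht => (ha t ht).summable)
  have h := tsum_nat_mul_eq_mul_deriv hc z
  have he : (fun z : ℂ => ∑' n : ℕ, (n : ℂ) * a n * z ^ n) =ᶠ[𝓝 z]
      fun z => canonicalProduct b z * ∑' j, z / (b j + z) := by
    filter_upwards [(isOpen_lt continuous_const Complex.continuous_re).mem_nhds hz] with w hw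
    exact tsum_nat_mul_pow_eq hb hsum ha hw
  rw [he.deriv_eq, deriv_fun_mul (differentiable_canonicalProduct hb hsum z)
    (differentiableAt_tsum_div_add hb hsum hz)] at h
  rw [(hasSum_mul_deriv_tsum_div_add hb hsum hz).tsum_eq]
  calc _ = ∑' n : ℕ, (n : ℂ) * (n * a n) * z ^ n := tsum_congr fun n => by ring
    _ = (z * deriv (canonicalProduct b) z) * (∑' j, z / (b j + z)) + canonicalProduct b z *
          (z * deriv (fun w : ℂ => ∑' j, w / (b j + w)) z) := by rw [h]; ring
    _ = _ := by rw [mul_deriv_canonicalProduct hb hsum hz]; ring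

lemma mf_eq_tsum (hb : ∀ j, 0 < b j) (hsum : Summable fun j => 1 / b j)
    (ha : ∀ t : ℝ, 0 ≤ t → HasSum (fun n : ℕ => a n * t ^ n) (∏' j : ℕ, (1 + t / b j)))
    {t : ℝ} (ht : 0 < t) : mf a t = ∑' j, t / (b j + t) := by
  have hz : 0 < (t : ℂ).re := ht
  have h := tsum_nat_mul_pow_eq hb hsum ha hz
  apply Complex.ofReal_injective
  rw [mf, Complex.ofReal_div, ofReal_fsum hb hsum ha,
    div_eq_iff (canonicalProduct_ne_zero hb hsum hz), mul_comm]
  push_cast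
  exact h

lemma sigma2_eq_tsum (hb : ∀ j, 0 < b j) (hsum : Summable fun j => 1 / b j)
    (ha : ∀ t : ℝ, 0 ≤ t → HasSum (fun n : ℕ => a n * t ^ n) (∏' j : ℕ, (1 + t / b j)))
    {t : ℝ} (ht : 0 < t) :
    sigma2 a t = ∑' j, t / (b j + t) * (1 - t / (b j + t)) := by
  have hz : 0 < (t : ℂ).re := ht
  have h := tsum_nat_sq_mul_pow_eq hb hsum ha hz
  rw [sigma2, mf_eq_tsum hb hsum ha ht, sub_eq_iff_eq_add']
  apply Complex.ofReal_injective
  rw [Complex.ofReal_div, ofReal_fsum hb hsum ha,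
    div_eq_iff (canonicalProduct_ne_zero hb hsum hz), mul_comm]
  push_cast
  exact h

lemma charfun_eq (hb : ∀ j, 0 < b j) (hsum : Summable fun j => 1 / b j)
    (ha : ∀ t : ℝ, 0 ≤ t → HasSum (fun n : ℕ => a n * t ^ n) (∏' j : ℕ, (1 + t / b j)))
    (t θ : ℝ) : charfun a t θ =
      canonicalProduct b (t * Complex.exp (Complex.I * (θ / sigma a t : ℝ))) /
        canonicalProduct b t * Complex.exp (-(Complex.I * (θ / sigma a t : ℝ) * mf a t)) := by
  rw [← ofReal_fsum hb hsum ha, ← tsum_mul_pow_eq_canonicalProduct hb hsum ha, charfun,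
    ← tsum_div_const, ← tsum_mul_right]
  refine tsum_congr fun n => ?_
  have h : Complex.exp (Complex.I * θ * (((n - mf a t) / sigma a t : ℝ) : ℂ)) =
      Complex.exp (Complex.I * (θ / sigma a t : ℝ)) ^ n *
        Complex.exp (-(Complex.I * (θ / sigma a t : ℝ) * mf a t)) := by
    rw [← Complex.exp_nat_mul, ← Complex.exp_add]
    congr 1
    push_cast
    ring
  rw [h, mul_pow]
  push_cast
  ring

lemma tendsto_prod_bernoulliCharfun (hb : ∀ j, 0 < b j) (hsum : Summable fun j => 1 / b j)
    (ha : ∀ t : ℝ, 0 ≤ t → HasSum (fun n : ℕ => a n * t ^ n) (∏' j : ℕ, (1 + t / b j)))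
    {t : ℝ} (ht : 0 < t) (θ : ℝ) :
    Tendsto (fun s : Finset ℕ => ∏ j ∈ s, bernoulliCharfun (t / (b j + t)) (θ / sigma a t)) atTop
      (𝓝 (charfun a t θ)) := by
  have hz : 0 < (t : ℂ).re := ht
  set x := θ / sigma a t with hx
  have hm : HasSum (fun j => ((t / (b j + t) : ℝ) : ℂ)) (mf a t) := by
    rw [mf_eq_tsum hb hsum ha ht]
    push_cast
    exact (summable_div_add hb hsum hz).hasSum
  have h₁ := hasProd_canonicalProduct hb hsum (t * Complex.exp (Complex.I * x))
  have h₂ := hasProd_canonicalProduct hb hsum t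
  have h₃ := (hm.mul_left (-(Complex.I * x))).cexp
  rw [charfun_eq hb hsum ha, ← hx, ← neg_mul]
  refine ((Tendsto.div h₁ h₂ (canonicalProduct_ne_zero hb hsum hz)).mul h₃).congr fun s => ?_
  simp only [Function.comp_apply]
  rw [Pi.div_apply, ← Finset.prod_div_distrib, ← Finset.prod_mul_distrib]
  exact Finset.prod_congr rfl fun j _ => (bernoulliCharfun_div_add (hb j) ht x).symm

lemma norm_charfun_sub_le (hb : ∀ j, 0 < b j) (hsum : Summable fun j => 1 / b j)
    (ha : ∀ t : ℝ, 0 ≤ t → HasSum (fun n : ℕ => a n * t ^ n) (∏' j : ℕ, (1 + t / b j)))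
    {t θ : ℝ} (ht : 0 < t) (hσ : 0 < sigma2 a t) (hθ : |θ| ≤ sigma a t) :
    ‖charfun a t θ - Complex.exp (-(θ : ℂ) ^ 2 / 2)‖ ≤ 2 * |θ| ^ 3 / sigma a t := by
  have hs : 0 < sigma a t := Real.sqrt_pos.2 hσ
  have hsq : sigma a t ^ 2 = sigma2 a t := Real.sq_sqrt hσ.le
  set x := θ / sigma a t with hx
  have hx₁ : |x| ≤ 1 := by
    rw [hx, abs_div, abs_of_pos hs]
    exact div_le_one_of_le₀ hθ hs.le
  have hp₀ (j : ℕ) : 0 ≤ t / (b j + t) := by have := hb j; positivity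
  have hp₁ (j : ℕ) : t / (b j + t) ≤ 1 :=
    div_le_one_of_le₀ (by linarith [hb j]) (by linarith [hb j])
  have hV : HasSum (fun j => t / (b j + t) * (1 - t / (b j + t))) (sigma2 a t) := by
    rw [sigma2_eq_tsum hb hsum ha ht]
    by_contra h
    rw [sigma2_eq_tsum hb hsum ha ht, tsum_eq_zero_of_not_summable fun h' => h h'.hasSum] at hσ
    exact hσ.false
  have hlim := (Complex.hasSum_ofReal.2 (hV.mul_left (x ^ 2 / 2)).neg).cexp
  have hval : ((-(x ^ 2 / 2 * sigma2 a t) : ℝ) : ℂ) = -(θ : ℂ) ^ 2 / 2 := by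
    have : -(x ^ 2 / 2 * sigma2 a t) = -θ ^ 2 / 2 := by
      rw [hx, ← hsq]
      field_simp
    rw [this]
    push_cast
    rfl
  rw [hval] at hlim
  have hbound := hV.mul_left (2 * |x| ^ 3)
  have hval' : 2 * |x| ^ 3 * sigma2 a t = 2 * |θ| ^ 3 / sigma a t := by
    rw [hx, abs_div, abs_of_pos hs, ← hsq]
    field_simp
  rw [hval'] at hbound
  refine le_of_tendsto_of_tendsto
    ((tendsto_prod_bernoulliCharfun hb hsum ha ht θ).sub hlim).norm hbound
    (.of_forall fun s => ?_)
  refine (norm_prod_sub_prod_le s (fun j => norm_bernoulliCharfun_le (hp₀ j) (hp₁ j) _)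
    fun j => ?_).trans
    (Finset.sum_le_sum fun j _ => norm_bernoulliCharfun_sub_le (hp₀ j) (hp₁ j) hx₁)
  have : 0 ≤ t / (b j + t) * (1 - t / (b j + t)) := mul_nonneg (hp₀ j) (sub_nonneg.2 (hp₁ j))
  simp only [Function.comp_apply, Complex.norm_exp, Complex.ofReal_re, Real.exp_le_one_iff]
  have : 0 ≤ x ^ 2 / 2 * (t / (b j + t) * (1 - t / (b j + t))) := by positivity
  linarith

end Coefficients

end KhinchinPaper

namespace KhinchinPaper

/-- a canonical product `f ∈ 𝒬`, `f(z) = ∏ (1 + z/b_j)`, with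
`σ_f²(t) → ∞` as `t → ∞`, is Gaussian. The coefficients `a` of `f` are characterized by
the product identity. -/
theorem statement18 (b : ℕ → ℝ) (hb : ∀ j, 0 < b j) (hmono : Monotone b)
    (hsum : Summable fun j => 1 / b j) (a : ℕ → ℝ)
    (ha : ∀ t : ℝ, 0 ≤ t → HasSum (fun n : ℕ => a n * t ^ n) (∏' j : ℕ, (1 + t / b j)))
    (hvar : Tendsto (fun t => sigma2 a t) atTop atTop) :
    IsGaussianEntire a := by
  intro θ
  have hσ : Tendsto (fun t => sigma a t) atTop atTop := Real.tendsto_sqrt_atTop.comp hvar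
  rw [tendsto_iff_norm_sub_tendsto_zero]
  refine squeeze_zero' (.of_forall fun _ => norm_nonneg _) ?_
    (hσ.const_div_atTop (2 * |θ| ^ 3))
  filter_upwards [eventually_gt_atTop 0, hvar.eventually_gt_atTop 0,
    hσ.eventually_ge_atTop |θ|] with t ht hv hθ
  exact norm_charfun_sub_le hb hsum ha ht hv hθ

end KhinchinPaper
end
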